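/- In the error expansion at grid points for the central finite difference discretisation of the Poisson problem (with u ∈ X_4^d(K) solving Δu = f, u|_{∂[0,1]^d} = 0), the weight functions w_J can be chosen so that, in addition, for every nonempty J ⊆ {1,…,d} with |J| = m, every choice of dyadic mesh sizes (h_j)_{j∈J}, and every multi-index α ∈ {0,4}^d with α_j = 0 for all j ∈ J, the derivative D^α w_J(·;(h_j)_{j∈J}) (taken in the coordinate directions not in J, along the hyperplanes constituting I^{(J)}) exists and satisfies ‖D^α w_J(·;(h_j)_{j∈J})‖_∞ ≤ K·m!/96^m. -/

import Mathlib

/-- Partial derivative of `u` in direction `i` (one-sided within `[0,1]` at the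
boundary): `∂ᵢu(x) = d/dt u(x₁,…,t,…,x_d)|_{t = xᵢ}` taken within `[0,1]`. -/
noncomputable def pd (d : ℕ) (i : Fin d) (u : (Fin d → ℝ) → ℝ) : (Fin d → ℝ) → ℝ :=
  fun x => derivWithin (fun t => u (Function.update x i t)) (Set.Icc 0 1) (x i)

/-- Mixed partial derivative `D^α u = ∂₁^{α₁} ⋯ ∂_d^{α_d} u`. -/
noncomputable def mderiv (d : ℕ) (α : Fin d → ℕ) (u : (Fin d → ℝ) → ℝ) :
    (Fin d → ℝ) → ℝ :=
  (List.finRange d).foldr (fun i v => (pd d i)^[α i] v) u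

/-- The closed unit cube `[0,1]^d`. -/
def unitCube (d : ℕ) : Set (Fin d → ℝ) := Set.Icc 0 1

/-- The open unit cube `(0,1)^d`. -/
def openCube (d : ℕ) : Set (Fin d → ℝ) := Set.pi Set.univ fun _ => Set.Ioo (0 : ℝ) 1

/-- The boundary `∂[0,1]^d`. -/
def cubeBdry (d : ℕ) : Set (Fin d → ℝ) := {x ∈ unitCube d | ∃ i, x i = 0 ∨ x i = 1}

/-- All mixed partial derivatives `D^β f`, `β ≤ α`, exist on `s` (each step of the
iterated differentiation is differentiable within `[0,1]` in its direction). -/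
def HasDerivsOn (d : ℕ) (α : Fin d → ℕ) (f : (Fin d → ℝ) → ℝ)
    (s : Set (Fin d → ℝ)) : Prop :=
  ∀ β : Fin d → ℕ, (∀ i, β i ≤ α i) → ∀ i : Fin d, β i < α i → ∀ x ∈ s,
    DifferentiableWithinAt ℝ (fun t => mderiv d β f (Function.update x i t))
      (Set.Icc 0 1) (x i)

/-- `u ∈ X_k^d`: all mixed derivatives `D^α u`, `α ∈ {0,…,k}^d`, exist, are
continuous on `[0,1]^d` and vanish on the boundary. -/
def MemX (d k : ℕ) (u : (Fin d → ℝ) → ℝ) : Prop :=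
  HasDerivsOn d (fun _ => k) u (unitCube d) ∧
  ∀ α : Fin d → ℕ, (∀ i, α i ≤ k) →
    ContinuousOn (mderiv d α u) (unitCube d) ∧
    ∀ x ∈ cubeBdry d, mderiv d α u x = 0

/-- `u ∈ X_k^d(K)`: additionally all these derivatives are bounded by `K`. -/
def MemXb (d k : ℕ) (K : ℝ) (u : (Fin d → ℝ) → ℝ) : Prop :=
  MemX d k u ∧
  ∀ α : Fin d → ℕ, (∀ i, α i ≤ k) → ∀ x ∈ unitCube d, |mderiv d α u x| ≤ K

/-- Mesh size `h_k = 2^{-lvl_k}` attached to a level vector. -/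
noncomputable def hmesh (d : ℕ) (lvl : Fin d → ℕ) (k : Fin d) : ℝ := ((2 : ℝ) ^ lvl k)⁻¹

/-- The grid point with index `i` on the grid of level `lvl`. -/
noncomputable def gridpt (d : ℕ) (lvl : Fin d → ℕ) (i : Fin d → ℕ) : Fin d → ℝ :=
  fun k => (i k : ℝ) * hmesh d lvl k

/-- Valid grid indices: `0 ≤ i_k ≤ 2^{lvl_k}`. -/
def IsGridIdx (d : ℕ) (lvl : Fin d → ℕ) (i : Fin d → ℕ) : Prop := ∀ k, i k ≤ 2 ^ lvl k

/-- The hyperplane set `I^{(J)} = {x ∈ [0,1]^d : x_j/h_j ∈ ℤ for j ∈ J}`. -/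
def Iplane (d : ℕ) (J : Finset (Fin d)) (lvl : Fin d → ℕ) : Set (Fin d → ℝ) :=
  {x ∈ unitCube d | ∀ j ∈ J, ∃ m : ℤ, x j = (m : ℝ) * hmesh d lvl j}

/-- `U` is the central finite difference solution of the Poisson problem `Δu = f`
with zero Dirichlet data on the grid of level `lvl`. -/
def IsFDPoisson (d : ℕ) (lvl : Fin d → ℕ) (f : (Fin d → ℝ) → ℝ)
    (U : (Fin d → ℕ) → ℝ) : Prop :=
  (∀ i : Fin d → ℕ, IsGridIdx d lvl i → (∃ k, i k = 0 ∨ i k = 2 ^ lvl k) → U i = 0) ∧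
  (∀ i : Fin d → ℕ, (∀ k, 1 ≤ i k ∧ i k < 2 ^ lvl k) →
    ∑ k, (U (Function.update i k (i k + 1)) - 2 * U i + U (Function.update i k (i k - 1)))
        / hmesh d lvl k ^ 2
      = f (gridpt d lvl i))

/-- `U` is the upwind (implicit Euler) solution of the advection equation
`Σᵢ ∂ᵢu = 0` on the grid of level `lvl`, with inflow data given by `u`. -/
def IsUpwindSol (d : ℕ) (lvl : Fin d → ℕ) (u : (Fin d → ℝ) → ℝ)
    (U : (Fin d → ℕ) → ℝ) : Prop :=
  (∀ i : Fin d → ℕ, IsGridIdx d lvl i → (∃ k, i k = 0) → U i = u (gridpt d lvl i)) ∧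
  (∀ i : Fin d → ℕ, IsGridIdx d lvl i → (∀ k, 1 ≤ i k) →
    ∑ k, (U i - U (Function.update i k (i k - 1))) / hmesh d lvl k = 0)

/-- `g` is the multilinear interpolant of the grid function `U` on the grid of
level `lvl`: it agrees with `U` at all grid points and is a polynomial of degree
at most `1` in each variable on each grid cell. -/
def IsInterp (d : ℕ) (lvl : Fin d → ℕ) (U : (Fin d → ℕ) → ℝ)
    (g : (Fin d → ℝ) → ℝ) : Prop :=
  (∀ i : Fin d → ℕ, IsGridIdx d lvl i → g (gridpt d lvl i) = U i) ∧
  (∀ j : Fin d → ℕ, (∀ k, j k < 2 ^ lvl k) →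
    ∃ c : Finset (Fin d) → ℝ, ∀ x : Fin d → ℝ,
      (∀ k, (j k : ℝ) * hmesh d lvl k ≤ x k ∧ x k ≤ ((j k : ℝ) + 1) * hmesh d lvl k) →
      g x = ∑ T : Finset (Fin d), c T * ∏ k ∈ T, x k)

/-- The domain `{x : x ± h e_k ∈ [0,1]^d}` of the truncation error terms. -/
def diffDom (d : ℕ) (k : Fin d) (h : ℝ) : Set (Fin d → ℝ) :=
  {x | Function.update x k (x k + h) ∈ unitCube d ∧
       Function.update x k (x k - h) ∈ unitCube d}

section HeatSemigroup

open MeasureTheory ProbabilityTheory Filter Topology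

theorem integrable_id_gaussian : Integrable (fun t : ℝ => t) (gaussianReal 0 1) := by
  have := (memLp_id_gaussianReal' (μ := 0) (v := 1) 1 (by simp)).integrable le_rfl
  exact this

/-- Gaussian integration by parts on the line. -/
theorem integral_id_mul_gaussian {f f' : ℝ → ℝ} (hf : ∀ t, HasDerivAt f (f' t) t)
    (hf' : Continuous f') {C : ℝ} (hC : ∀ t, |f t| ≤ C) (hC' : ∀ t, |f' t| ≤ C) :
    ∫ t, t * f t ∂(gaussianReal 0 1) = ∫ t, f' t ∂(gaussianReal 0 1) := by
  have hfc : Continuous f := continuous_iff_continuousAt.2 fun t => (hf t).continuousAt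
  have hi1 : Integrable (fun t => t * f t) (gaussianReal 0 1) := by
    refine (integrable_id_gaussian).mul_bdd (c := C) hfc.aestronglyMeasurable
      (ae_of_all _ fun t => ?_)
    simpa using hC t
  have hpdf : ∀ t, HasDerivAt (gaussianPDFReal 0 1) (-(t * gaussianPDFReal 0 1 t)) t := by
    intro t
    simp only [gaussianPDFReal_def]
    have h1 : HasDerivAt (fun x : ℝ => -(x - 0) ^ 2 / (2 * ((1 : NNReal) : ℝ))) (-t) t := by
      have := (((hasDerivAt_id t).sub_const (0:ℝ)).pow 2).neg.div_const (2 * ((1 : NNReal) : ℝ))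
      refine this.congr_deriv ?_
      simp
      ring
    refine (h1.exp.const_mul _).congr_deriv ?_
    ring
  have hw : ∀ g : ℝ → ℝ, Continuous g → Integrable g (gaussianReal 0 1) →
      Integrable (fun t => g t * gaussianPDFReal 0 1 t) := by
    intro g hg h
    rw [gaussianReal_of_var_ne_zero _ one_ne_zero,
      integrable_withDensity_iff_integrable_smul' (measurable_gaussianPDF _ _)
      (ae_of_all _ fun _ => gaussianPDF_lt_top)] at h
    refine h.congr (ae_of_all _ fun t => ?_)
    simp [toReal_gaussianPDF, mul_comm]
  have hib : ∀ g : ℝ → ℝ, Continuous g → (∀ t, |g t| ≤ C) → Integrable g (gaussianReal 0 1) := by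
    intro g hg h
    exact Integrable.of_bound hg.aestronglyMeasurable C (ae_of_all _ fun t => by simpa using h t)
  have hi2 := hw _ (by fun_prop) hi1
  have key := integral_mul_deriv_eq_deriv_mul_of_integrable (u := f) (u' := f')
    (v := gaussianPDFReal 0 1) (v' := fun t => -(t * gaussianPDFReal 0 1 t))
    (fun x _ => hf x) (fun x _ => hpdf x)
    (by refine hi2.neg.congr (ae_of_all _ fun t => ?_); simp; ring)
    (hw _ hf' (hib _ hf' hC')) (hw _ hfc (hib _ hfc hC))
  rw [integral_gaussianReal_eq_integral_smul one_ne_zero,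
    integral_gaussianReal_eq_integral_smul one_ne_zero]
  have e1 : ∫ x, f x * -(x * gaussianPDFReal 0 1 x) = -∫ x, gaussianPDFReal 0 1 x • (x * f x) := by
    rw [← integral_neg]; congr 1; ext x; simp; ring
  rw [e1, neg_inj] at key
  rw [key]; congr 1; ext x; simp; ring

/-- The standard Gaussian measure on `ℝ^d`. -/
noncomputable def gaussianPi (d : ℕ) : Measure (Fin d → ℝ) :=
  Measure.pi fun _ => gaussianReal 0 1

instance (d : ℕ) : IsProbabilityMeasure (gaussianPi d) := by
  unfold gaussianPi; infer_instance

theorem integrable_coord_gaussianPi (d : ℕ) (k : Fin d) :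
    Integrable (fun z : Fin d → ℝ => z k) (gaussianPi d) := by
  have := (measurePreserving_eval (fun _ : Fin d => gaussianReal 0 1) k).integrable_comp
    (g := fun t : ℝ => t) (by fun_prop)
  exact this.2 integrable_id_gaussian

/-- Gaussian integration by parts in the direction `k`. -/
theorem integral_coord_mul_gaussianPi {d : ℕ} (k : Fin d) {f f' : (Fin d → ℝ) → ℝ}
    (hf : ∀ z, HasDerivAt (fun t => f (Function.update z k t)) (f' z) (z k))
    (hfc : Continuous f) (hf' : Continuous f') {C : ℝ} (hC : ∀ t, |f t| ≤ C)
    (hC' : ∀ t, |f' t| ≤ C) :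
    ∫ z, z k * f z ∂(gaussianPi d) = ∫ z, f' z ∂(gaussianPi d) := by
  cases d with
  | zero => exact k.elim0
  | succ n =>
    have hmp := (measurePreserving_piFinSuccAbove
      (fun _ : Fin (n + 1) => gaussianReal 0 1) k).symm
    unfold gaussianPi
    have hi1 : Integrable (fun z => z k * f z) (gaussianPi (n + 1)) :=
      (integrable_coord_gaussianPi _ k).mul_bdd (c := C) hfc.aestronglyMeasurable
        (ae_of_all _ fun t => by simpa using hC t)
    have hi2 : Integrable f' (gaussianPi (n + 1)) :=
      Integrable.of_bound hf'.aestronglyMeasurable C (ae_of_all _ fun t => by simpa using hC' t)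
    rw [← hmp.integral_comp', ← hmp.integral_comp']
    rw [integral_prod_symm, integral_prod_symm]
    · congr 1
      ext y
      have hup : ∀ t s : ℝ, Function.update (k.insertNth t y : Fin (n + 1) → ℝ) k s
          = k.insertNth s y := fun t s => by simp
      have hcont : Continuous fun t : ℝ => (k.insertNth t y : Fin (n + 1) → ℝ) := by
        have := continuous_const.update k continuous_id (f := fun _ : ℝ => (k.insertNth 0 y : Fin (n + 1) → ℝ))
        refine this.congr fun t => ?_
        simp
      have := integral_id_mul_gaussian (f := fun t => f (k.insertNth t y))
        (f' := fun t => f' (k.insertNth t y)) (fun t => by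
          have := hf (k.insertNth t y)
          simpa [hup] using this) (by fun_prop) (fun t => hC _) (fun t => hC' _)
      simpa [Fin.insertNthEquiv] using this
    · exact (hmp.integrable_comp_emb (MeasurableEquiv.measurableEmbedding _)).2 hi2
    · exact (hmp.integrable_comp_emb (MeasurableEquiv.measurableEmbedding _)).2 hi1

/-- The Gaussian measure is invariant under reflecting one coordinate. -/
theorem measurePreserving_reflect_gaussianPi {d : ℕ} (k : Fin d) :
    MeasurePreserving (fun z : Fin d → ℝ => Function.update z k (-z k))
      (gaussianPi d) (gaussianPi d) := by
  have h := measurePreserving_pi (fun _ : Fin d => gaussianReal 0 1)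
    (fun _ : Fin d => gaussianReal 0 1)
    (f := fun i t => if i = k then -t else t) (fun i => by
      by_cases h : i = k
      · simp only [h, if_true]
        exact ⟨measurable_neg, by simpa using gaussianReal_map_neg (μ := 0) (v := 1)⟩
      · simp only [h, if_false]
        exact MeasurePreserving.id _)
  refine (congrArg (fun f => MeasurePreserving f (gaussianPi d) (gaussianPi d)) ?_).mp h
  ext z i
  by_cases hi : i = k
  · subst hi; simp
  · simp [hi]

/-- The chain rule along a line for a function with continuous partial derivatives. -/
theorem hasDerivAt_line_of_partial {d : ℕ} {g : (Fin d → ℝ) → ℝ} {g' : Fin d → (Fin d → ℝ) → ℝ}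
    (hg : ∀ k x, HasDerivAt (fun t => g (Function.update x k t)) (g' k x) (x k))
    (hc : ∀ k, Continuous (g' k)) (x z : Fin d → ℝ) (s : ℝ) :
    HasDerivAt (fun s : ℝ => g (x + s • z)) (∑ k, z k * g' k (x + s • z)) s := by
  classical
  suffices h : ∀ T : Finset (Fin d), ∀ x s,
      HasDerivAt (fun s : ℝ => g (x + s • (T.piecewise z 0)))
      (∑ k ∈ T, z k * g' k (x + s • (T.piecewise z 0))) s by
    simpa using h Finset.univ x s
  intro T
  induction T using Finset.induction_on with
  | empty => intro x s; simpa using hasDerivAt_const s (g x)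
  | insert k T hk ih =>
    intro x s
    have hsplit : ∀ a b : ℝ, ∀ i, i = k → (x + a • (Pi.single k (z k) : Fin d → ℝ) + b • (T.piecewise z 0 : Fin d → ℝ)) i
        = x i + a * z i := by
      rintro a b i rfl; simp [hk]
    have hins : ∀ s : ℝ, x + s • (Finset.piecewise (insert k T) z 0)
        = x + s • Pi.single k (z k) + s • (T.piecewise z 0) := by
      intro s; ext i
      by_cases hi : i = k
      · subst hi; simp [hk]
      · simp [hi, Finset.piecewise]
    let F : ℝ → ℝ → ℝ := fun a b => g (x + a • Pi.single k (z k) + b • (T.piecewise z 0))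
    let F₁ : ℝ → ℝ → ℝ →L[ℝ] ℝ := fun a b => ContinuousLinearMap.toSpanSingleton ℝ
      (z k * g' k (x + a • Pi.single k (z k) + b • (T.piecewise z 0)))
    let F₂ : ℝ → ℝ → ℝ →L[ℝ] ℝ := fun a b => ContinuousLinearMap.toSpanSingleton ℝ
      (∑ i ∈ T, z i * g' i (x + a • Pi.single k (z k) + b • (T.piecewise z 0)))
    have d1 : ∀ v : ℝ × ℝ, HasFDerivAt (F · v.2) (F₁ v.1 v.2) v.1 := by
      rintro ⟨a, b⟩
      refine HasDerivAt.hasFDerivAt ?_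
      set y := x + a • Pi.single k (z k) + b • (T.piecewise z 0) with hy
      have h1 := hg k y
      have hyk : y k = x k + a * z k := hsplit a b k rfl
      rw [hyk] at h1
      have h2 : HasDerivAt (fun a : ℝ => x k + a * z k) (z k) a := by
        simpa using ((hasDerivAt_id a).mul_const (z k)).const_add (x k)
      have h3 := h1.comp a h2
      refine (h3.congr_deriv (by ring)).congr_of_eventuallyEq (Eventually.of_forall fun a' => ?_)
      simp only [F, Function.comp]
      congr 1
      ext i
      by_cases hi : i = k
      · subst hi; simp [hk]
      · simp [hi, hy]
    have d2 : ∀ v : ℝ × ℝ, HasFDerivAt (F v.1 ·) (F₂ v.1 v.2) v.2 := by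
      rintro ⟨a, b⟩
      exact HasDerivAt.hasFDerivAt (ih _ _)
    have c1 : Continuous ↿F₁ := by
      have := hc k
      show Continuous fun v : ℝ × ℝ => F₁ v.1 v.2
      refine (ContinuousLinearMap.toSpanSingletonCLE (𝕜 := ℝ) (E := ℝ)).continuous.comp ?_
      fun_prop
    have c2 : Continuous ↿F₂ := by
      show Continuous fun v : ℝ × ℝ => F₂ v.1 v.2
      refine (ContinuousLinearMap.toSpanSingletonCLE (𝕜 := ℝ) (E := ℝ)).continuous.comp ?_
      refine continuous_finsetSum _ fun i _ => ?_
      have := hc i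
      fun_prop
    have key := (hasStrictFDerivAt_uncurry_coprod (u := (s, s)) (f := F) (f₁ := F₁) (f₂ := F₂)
      (Eventually.of_forall d1) (Eventually.of_forall d2) c1.continuousAt
      c2.continuousAt).hasFDerivAt
    have hl : HasDerivAt (fun s : ℝ => (s, s)) ((1 : ℝ), (1 : ℝ)) s :=
      (hasDerivAt_id s).prodMk (hasDerivAt_id s)
    have := HasFDerivAt.comp_hasDerivAt (f := fun s : ℝ => (s, s)) s key hl
    refine (this.congr_deriv ?_).congr_of_eventuallyEq (Eventually.of_forall fun s' => ?_)
    · rw [Finset.sum_insert hk, hins]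
      show ((F₁ s s).coprod (F₂ s s)) (1, 1) = _
      simp [F₁, F₂]
    · simp only [hins]; rfl

end HeatSemigroup

section GaussianAverage

open MeasureTheory ProbabilityTheory Filter Topology

/-- The average of `g` over the Gaussian measure with standard deviation `s` centred at `x`. -/
noncomputable def gaussAvg {d : ℕ} (g : (Fin d → ℝ) → ℝ) (s : ℝ) (x : Fin d → ℝ) : ℝ :=
  ∫ z, g (x + s • z) ∂(gaussianPi d)

section gaussAvg

variable {d : ℕ} {g g' : (Fin d → ℝ) → ℝ} {C : ℝ}

theorem integrable_gaussAvg (hg : Continuous g) (hC : ∀ x, |g x| ≤ C) (s : ℝ) (x : Fin d → ℝ) :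
    Integrable (fun z => g (x + s • z)) (gaussianPi d) :=
  Integrable.of_bound (by fun_prop : Continuous fun z => g (x + s • z)).aestronglyMeasurable C
    (ae_of_all _ fun t => by simpa using hC _)

theorem continuous_gaussAvg (hg : Continuous g) (hC : ∀ x, |g x| ≤ C) :
    Continuous fun p : ℝ × (Fin d → ℝ) => gaussAvg g p.1 p.2 := by
  unfold gaussAvg
  refine continuous_of_dominated (bound := fun _ => C) (fun p => ?_) (fun p => ?_)
    (integrable_const C) ?_
  · exact (by fun_prop : Continuous fun z => g (p.2 + p.1 • z)).aestronglyMeasurable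
  · exact ae_of_all _ fun z => by simpa using hC _
  · exact ae_of_all _ fun z => by fun_prop

theorem abs_gaussAvg_le (hC : ∀ x, |g x| ≤ C) (s : ℝ) (x : Fin d → ℝ) :
    |gaussAvg g s x| ≤ C := by
  unfold gaussAvg
  have := norm_integral_le_of_norm_le_const (μ := gaussianPi d) (C := C)
    (f := fun z => g (x + s • z)) (ae_of_all _ fun z => by simpa using hC _)
  simpa using this

theorem gaussAvg_zero (x : Fin d → ℝ) : gaussAvg g 0 x = g x := by
  simp [gaussAvg]

theorem update_add_smul (x z : Fin d → ℝ) (k : Fin d) (t s : ℝ) :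
    Function.update x k t + s • z = Function.update (x + s • z) k (t + s * z k) := by
  ext i
  by_cases h : i = k
  · subst h; simp
  · simp [h]

theorem hasDerivAt_gaussAvg_coord (hg : Continuous g) (hC : ∀ x, |g x| ≤ C)
    (hg' : Continuous g') (hC' : ∀ x, |g' x| ≤ C) (k : Fin d)
    (h : ∀ x, HasDerivAt (fun t => g (Function.update x k t)) (g' x) (x k))
    (s : ℝ) (x : Fin d → ℝ) :
    HasDerivAt (fun t => gaussAvg g s (Function.update x k t)) (gaussAvg g' s x) (x k) := by
  have key := hasDerivAt_integral_of_dominated_loc_of_deriv_le (μ := gaussianPi d)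
    (F := fun t z => g (Function.update x k t + s • z))
    (F' := fun t z => g' (Function.update x k t + s • z)) (x₀ := x k) (s := Set.univ)
    (bound := fun _ => C) univ_mem
    (Eventually.of_forall fun t => by
      exact (by fun_prop : Continuous fun z => g (Function.update x k t + s • z)).aestronglyMeasurable)
    (integrable_gaussAvg hg hC _ _)
    (by exact (by fun_prop : Continuous fun z =>
      g' (Function.update x k (x k) + s • z)).aestronglyMeasurable)
    (ae_of_all _ fun z t _ => by simpa using hC' _) (integrable_const C)
    (ae_of_all _ fun z t _ => by
      have h1 := h (Function.update x k t + s • z)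
      simp only [update_add_smul] at h1 ⊢
      simp only [Function.update_self, Function.update_idem] at h1
      have := h1.comp t ((hasDerivAt_id t).add_const (s * z k))
      simpa [Function.comp_def] using this)
  have := key.2
  simp only [Function.update_eq_self] at this
  exact this

theorem gaussAvg_update_of_const {k : Fin d} (h : ∀ x t, g (Function.update x k t) = g x)
    (s : ℝ) (x : Fin d → ℝ) (t : ℝ) : gaussAvg g s (Function.update x k t) = gaussAvg g s x := by
  unfold gaussAvg
  simp only [update_add_smul, h]

theorem gaussAvg_reflect {k : Fin d} {b : ℝ}
    (h : ∀ x, g (Function.update x k (b - x k)) = -g x)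
    (s : ℝ) (x : Fin d → ℝ) :
    gaussAvg g s (Function.update x k (b - x k)) = -gaussAvg g s x := by
  unfold gaussAvg
  rw [← integral_neg]
  have hinv : Function.Involutive fun z : Fin d → ℝ => Function.update z k (-z k) := by
    intro z; simp
  have hm : Measurable fun z : Fin d → ℝ => Function.update z k (-z k) :=
    (measurePreserving_reflect_gaussianPi k).measurable
  have := (measurePreserving_reflect_gaussianPi (d := d) k).integral_comp
    (MeasurableEquiv.measurableEmbedding
      (⟨hinv.toPerm, hm, hm⟩ : (Fin d → ℝ) ≃ᵐ (Fin d → ℝ)))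
    (fun z => g (Function.update x k (b - x k) + s • z))
  rw [← this]
  congr 1
  ext z
  rw [← h]
  congr 1
  ext i
  by_cases hi : i = k
  · subst hi; simp; ring
  · simp [hi]

/-- The heat equation for Gaussian averages, in the variable `s = √(2 * t)`. -/
theorem hasDerivAt_gaussAvg_scale {g₁ g₂ : Fin d → (Fin d → ℝ) → ℝ}
    (hg : Continuous g) (hC : ∀ x, |g x| ≤ C)
    (hg₁ : ∀ k, Continuous (g₁ k)) (hC₁ : ∀ k x, |g₁ k x| ≤ C)
    (hg₂ : ∀ k, Continuous (g₂ k)) (hC₂ : ∀ k x, |g₂ k x| ≤ C)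
    (h₁ : ∀ k x, HasDerivAt (fun t => g (Function.update x k t)) (g₁ k x) (x k))
    (h₂ : ∀ k x, HasDerivAt (fun t => g₁ k (Function.update x k t)) (g₂ k x) (x k))
    (x : Fin d → ℝ) (s : ℝ) :
    HasDerivAt (fun s => gaussAvg g s x) (s * ∑ k, gaussAvg (g₂ k) s x) s := by
  have key := hasDerivAt_integral_of_dominated_loc_of_deriv_le (μ := gaussianPi d)
    (F := fun s z => g (x + s • z))
    (F' := fun s z => ∑ k, z k * g₁ k (x + s • z)) (x₀ := s) (s := Set.univ)
    (bound := fun z => ∑ k, |z k| * C) univ_mem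
    (Eventually.of_forall fun t => by
      exact (by fun_prop : Continuous fun z => g (x + t • z)).aestronglyMeasurable)
    (integrable_gaussAvg hg hC _ _)
    (by exact (by fun_prop : Continuous fun z =>
      ∑ k, z k * g₁ k (x + s • z)).aestronglyMeasurable)
    (ae_of_all _ fun z t _ => by
      refine (norm_sum_le _ _).trans (Finset.sum_le_sum fun k _ => ?_)
      rw [norm_mul]
      exact mul_le_mul_of_nonneg_left (by simpa using hC₁ k _) (norm_nonneg _))
    (integrable_finsetSum _ fun k _ => (integrable_coord_gaussianPi d k).abs.mul_const C)
    (ae_of_all _ fun z t _ => hasDerivAt_line_of_partial h₁ hg₁ x z t)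
  refine key.2.congr_deriv ?_
  have h_int : ∀ k, Integrable (fun z : Fin d → ℝ => z k * g₁ k (x + s • z)) (gaussianPi d) :=
    fun k => (integrable_coord_gaussianPi d k).mul_bdd (c := C)
      (by have := hg₁ k; exact (by fun_prop : Continuous fun z =>
        g₁ k (x + s • z)).aestronglyMeasurable) (ae_of_all _ fun z => by simpa using hC₁ k _)
  rw [integral_finsetSum _ fun k _ => h_int k, Finset.mul_sum]
  refine Finset.sum_congr rfl fun k _ => ?_
  unfold gaussAvg
  rw [← integral_const_mul]
  have c1 := hg₁ k
  have c2 := hg₂ k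
  refine integral_coord_mul_gaussianPi (C := max C (|s| * C)) k
    (f := fun z => g₁ k (x + s • z)) (f' := fun z => s * g₂ k (x + s • z)) (fun z => ?_)
    (by fun_prop) (by fun_prop) (fun z => (hC₁ k _).trans (le_max_left _ _))
    (fun z => ?_)
  · have h3 := h₂ k (x + s • z)
    have h4 : HasDerivAt (fun t : ℝ => x k + s * t) s (z k) := by
      simpa using ((hasDerivAt_id (z k)).const_mul s).const_add (x k)
    have h5 := HasDerivAt.comp (z k) (h₂ := fun t => g₁ k (Function.update (x + s • z) k t))
      (by simpa using h3) h4
    refine (h5.congr_deriv (mul_comm _ _)).congr_of_eventuallyEq (Eventually.of_forall fun t => ?_)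
    simp only [Function.comp]
    congr 1
    ext i
    by_cases hi : i = k
    · subst hi; simp
    · simp [hi]
  · rw [abs_mul]
    exact (mul_le_mul_of_nonneg_left (hC₂ k _) (abs_nonneg s)).trans (le_max_right _ _)

end gaussAvg

end GaussianAverage

section MetzlerKernel

open MeasureTheory Filter Topology

section Kernel

open scoped Matrix.Norms.Operator

theorem exp_smul_matrix_nonneg {ι : Type*} [Fintype ι] [DecidableEq ι] {B : Matrix ι ι ℝ}
    (hB : ∀ p q, 0 ≤ B p q) {t : ℝ} (ht : 0 ≤ t) (p q : ι) :
    0 ≤ NormedSpace.exp (t • B) p q := by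
  have hpow : ∀ n : ℕ, ∀ p q, 0 ≤ ((t • B) ^ n) p q := by
    intro n
    induction n with
    | zero => intro p q; simp only [pow_zero, Matrix.one_apply]; split_ifs <;> norm_num
    | succ n ih =>
      intro p q
      rw [pow_succ, Matrix.mul_apply]
      exact Finset.sum_nonneg fun r _ => mul_nonneg (ih p r) (mul_nonneg ht (hB r q))
  have h := NormedSpace.exp_series_hasSum_exp' (𝕂 := ℝ) (t • B)
  have h2 := h.mapL ((Matrix.entryLinearMap ℝ ℝ p q).toContinuousLinearMap)
  exact h2.nonneg fun n => mul_nonneg (by positivity) (hpow n p q)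

/-- A finite matrix with nonnegative off-diagonal entries and a bounded positive strict
supersolution generates a positive semigroup whose potential is bounded by the supersolution;
the semigroup at time `s² / 2` is denoted by `E s`. -/
theorem exists_kernel {X : Type*} [DecidableEq X] (Q : Finset X) (a : X → X → ℝ)
    (hoff : ∀ p ∈ Q, ∀ q ∈ Q, p ≠ q → 0 ≤ a p q) (φ : X → ℝ)
    (hφ0 : ∀ p ∈ Q, 0 < φ p) (hφ1 : ∀ p ∈ Q, φ p ≤ 1 / 8)
    (hAφ : ∀ p ∈ Q, ∑ q ∈ Q, a p q * φ q ≤ -1) :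
    ∃ E : ℝ → X → X → ℝ,
      (∀ s p q, 0 ≤ E s p q) ∧
      (∀ s p q, p ∉ Q → E s p q = 0) ∧
      (∀ p ∈ Q, ∀ q ∈ Q, E 0 p q = if p = q then 1 else 0) ∧
      (∀ p ∈ Q, ∀ q ∈ Q, ∀ s, HasDerivAt (fun s => E s p q)
        (s * ∑ r ∈ Q, a p r * E s r q) s) ∧
      (∀ p, ∀ q ∈ Q, IntegrableOn (fun s => s * E s p q) (Set.Ioi 0)) ∧
      (∀ p, ∫ s in Set.Ioi (0 : ℝ), ∑ q ∈ Q, s * E s p q ≤ 1 / 8) ∧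
      (∀ p, ∀ q ∈ Q, Tendsto (fun s => E s p q) atTop (𝓝 0)) := by
  classical
  let A : Matrix Q Q ℝ := Matrix.of fun p q => a p q
  let c : ℝ := ∑ p : Q, |a p p|
  let B : Matrix Q Q ℝ := A + c • 1
  have hB : ∀ p q, 0 ≤ B p q := by
    intro p q
    by_cases h : p = q
    · subst h
      have h1 : |a p p| ≤ c := Finset.single_le_sum (f := fun p : Q => |a p p|)
        (fun _ _ => abs_nonneg _) (Finset.mem_univ p)
      have h2 := neg_abs_le (a p p)
      simp only [B, A, Matrix.add_apply, Matrix.of_apply, Matrix.smul_apply, Matrix.one_apply_eq,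
        smul_eq_mul, mul_one]
      linarith
    · have := hoff p p.2 q q.2 (fun h' => h (Subtype.ext h'))
      simpa [B, A, Matrix.one_apply_ne h] using this
  let E₀ : ℝ → Matrix Q Q ℝ := fun t => Real.exp (-c * t) • NormedSpace.exp (t • B)
  have hE₀ : ∀ t, 0 ≤ t → ∀ p q, 0 ≤ E₀ t p q := fun t ht p q =>
    mul_nonneg (Real.exp_pos _).le (exp_smul_matrix_nonneg hB ht p q)
  have hder1 : ∀ t, HasDerivAt E₀ (E₀ t * A) t := by
    intro t
    have h1 := hasDerivAt_exp_smul_const (𝕂 := ℝ) B t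
    have h2 : HasDerivAt (fun t => Real.exp (-c * t)) (Real.exp (-c * t) * -c) t := by
      simpa using ((hasDerivAt_id t).const_mul (-c)).exp
    refine (h2.smul h1).congr_deriv ?_
    simp only [E₀, B, mul_add, smul_mul_assoc, mul_smul_comm, mul_one]
    rw [smul_add, add_assoc, smul_smul, ← add_smul]
    simp only [mul_comm, mul_neg, neg_mul, add_neg_cancel, zero_smul, add_zero]
    rfl
  have hder2 : ∀ t, HasDerivAt E₀ (A * E₀ t) t := by
    intro t
    have h1 := hasDerivAt_exp_smul_const' (𝕂 := ℝ) B t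
    have h2 : HasDerivAt (fun t => Real.exp (-c * t)) (Real.exp (-c * t) * -c) t := by
      simpa using ((hasDerivAt_id t).const_mul (-c)).exp
    refine (h2.smul h1).congr_deriv ?_
    simp only [E₀, B, add_mul, smul_mul_assoc, mul_smul_comm, one_mul]
    rw [smul_add, add_assoc, smul_smul, ← add_smul]
    simp only [mul_comm, mul_neg, neg_mul, add_neg_cancel, zero_smul, add_zero]
    rfl
  have hentry : ∀ (p q : Q) (M' : Matrix Q Q ℝ) (t : ℝ), HasDerivAt E₀ M' t →
      HasDerivAt (fun t => E₀ t p q) (M' p q) t := by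
    intro p q M' t h
    exact ((Matrix.entryLinearMap ℝ ℝ p q).toContinuousLinearMap).hasFDerivAt.comp_hasDerivAt t h
  let v : Q → ℝ → ℝ := fun p t => ∑ q, E₀ t p q * φ q
  let v' : Q → ℝ → ℝ := fun p t => ∑ r, E₀ t p r * ∑ q : Q, a r q * φ q
  have hv : ∀ p t, HasDerivAt (v p) (v' p t) t := by
    intro p t
    have := HasDerivAt.fun_sum fun (q : Q) (_ : q ∈ Finset.univ) =>
      ((hentry p q _ t (hder1 t)).mul_const (φ q))
    refine this.congr_deriv ?_
    simp only [v', Matrix.mul_apply, Finset.sum_mul, Finset.mul_sum, A, Matrix.of_apply]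
    rw [Finset.sum_comm]
    exact Finset.sum_congr rfl fun _ _ => Finset.sum_congr rfl fun _ _ => by ring
  have hv'le : ∀ p t, 0 ≤ t → v' p t ≤ -∑ r, E₀ t p r := by
    intro p t ht
    rw [← Finset.sum_neg_distrib]
    refine Finset.sum_le_sum fun r _ => ?_
    have h1 : ∑ q : Q, a r q * φ q ≤ -1 := by
      rw [Finset.sum_coe_sort Q (fun q => a r q * φ q)]
      exact hAφ r r.2
    have := mul_le_mul_of_nonneg_left h1 (hE₀ t ht p r)
    linarith
  have hvle : ∀ p t, 0 ≤ t → 8 * v p t ≤ ∑ r, E₀ t p r := by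
    intro p t ht
    rw [Finset.mul_sum]
    refine Finset.sum_le_sum fun r _ => ?_
    have := mul_le_mul_of_nonneg_left (hφ1 r r.2) (hE₀ t ht p r)
    linarith
  have hv0 : ∀ p, v p 0 = φ p := by
    intro p
    simp [v, E₀, Matrix.one_apply]
  have hdecay : ∀ p t, 0 ≤ t → v p t ≤ Real.exp (-8 * t) * φ p := by
    intro p t ht
    have hd : ∀ t, HasDerivAt (fun t => Real.exp (8 * t) * v p t)
        (Real.exp (8 * t) * 8 * v p t + Real.exp (8 * t) * v' p t) t := by
      intro t
      have h2 : HasDerivAt (fun t => Real.exp (8 * t)) (Real.exp (8 * t) * 8) t := by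
        simpa using ((hasDerivAt_id t).const_mul 8).exp
      exact h2.mul (hv p t)
    have hanti : AntitoneOn (fun t => Real.exp (8 * t) * v p t) (Set.Ici 0) := by
      refine antitoneOn_of_hasDerivWithinAt_nonpos (convex_Ici 0)
        (fun t _ => (hd t).continuousAt.continuousWithinAt)
        (fun t _ => (hd t).hasDerivWithinAt) fun t ht => ?_
      rw [interior_Ici] at ht
      have h1 := hv'le p t (le_of_lt ht)
      have h2 := hvle p t (le_of_lt ht)
      have : Real.exp (8 * t) * 8 * v p t + Real.exp (8 * t) * v' p t
        = Real.exp (8 * t) * (8 * v p t + v' p t) := by ring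
      rw [this]
      exact mul_nonpos_of_nonneg_of_nonpos (Real.exp_pos _).le (by linarith)
    have := hanti (Set.mem_Ici.2 le_rfl) (Set.mem_Ici.2 ht) ht
    simp only [mul_zero, Real.exp_zero, one_mul, hv0] at this
    have h3 : Real.exp (-8 * t) * Real.exp (8 * t) = 1 := by
      rw [← Real.exp_add]; simp
    calc v p t = Real.exp (-8 * t) * (Real.exp (8 * t) * v p t) := by rw [← mul_assoc, h3, one_mul]
      _ ≤ _ := mul_le_mul_of_nonneg_left this (Real.exp_pos _).le
  have hEle : ∀ p q : Q, ∀ t, 0 ≤ t → E₀ t p q ≤ Real.exp (-8 * t) * (φ p / φ q) := by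
    intro p q t ht
    have h1 : E₀ t p q * φ q ≤ v p t := Finset.single_le_sum
      (f := fun q : Q => E₀ t p q * φ q)
      (fun r _ => mul_nonneg (hE₀ t ht p r) (hφ0 r r.2).le) (Finset.mem_univ q)
    have h2 := h1.trans (hdecay p t ht)
    rw [← mul_div_assoc, le_div_iff₀ (hφ0 q q.2)]
    exact h2
  let E : ℝ → X → X → ℝ := fun s p q =>
    if h : p ∈ Q ∧ q ∈ Q then E₀ (s ^ 2 / 2) ⟨p, h.1⟩ ⟨q, h.2⟩ else 0
  have hEQ : ∀ s (p q : Q), E s p q = E₀ (s ^ 2 / 2) p q := fun s p q => by simp [E]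
  have hEQ' : ∀ s p q, p ∉ Q → E s p q = 0 := fun s p q h => by simp [E, h]
  have hhalf : ∀ s : ℝ, HasDerivAt (fun s : ℝ => s ^ 2 / 2) s s := fun s => by
    refine ((hasDerivAt_pow 2 s).div_const 2).congr_deriv ?_
    simp
  have hEcont : ∀ p q : Q, Continuous fun s => E s p q := by
    intro p q
    simp only [hEQ]
    exact continuous_iff_continuousAt.2 fun s =>
      (HasDerivAt.comp (h₂ := fun t => E₀ t p q) s (hentry p q _ _ (hder1 (s ^ 2 / 2)))
        (hhalf s)).continuousAt
  have h_int : ∀ p q : Q, IntegrableOn (fun s => s * E s p q) (Set.Ioi 0) := by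
    intro p q
    have h1 := ((integrable_mul_exp_neg_mul_sq (b := 4) (by norm_num)).mul_const
      (φ p / φ q)).integrableOn (s := Set.Ioi (0 : ℝ))
    refine Integrable.mono' h1
      (by have := hEcont p q; exact (by fun_prop : Continuous fun s => s * E s p q).aestronglyMeasurable)
      ((ae_restrict_iff' measurableSet_Ioi).2 (ae_of_all _ fun s hs => ?_))
    have hs0 : (0 : ℝ) ≤ s := le_of_lt hs
    rw [hEQ, Real.norm_eq_abs, abs_of_nonneg (mul_nonneg hs0 (hE₀ _ (by positivity) p q)),
      mul_assoc]
    refine mul_le_mul_of_nonneg_left ((hEle p q _ (by positivity)).trans (le_of_eq ?_)) hs0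
    congr 2
    ring
  have hsq : Tendsto (fun s : ℝ => s ^ 2 / 2) atTop atTop :=
    (tendsto_pow_atTop two_ne_zero).atTop_div_const (by norm_num)
  have hexp : Tendsto (fun t : ℝ => Real.exp (-8 * t)) atTop (𝓝 0) := by
    refine Real.tendsto_exp_atBot.comp ?_
    exact tendsto_id.const_mul_atTop_of_neg (by norm_num)
  refine ⟨E, ?_, hEQ', ?_, ?_, ?_, ?_, ?_⟩
  · intro s p q
    by_cases h : p ∈ Q ∧ q ∈ Q
    · rw [hEQ s ⟨p, h.1⟩ ⟨q, h.2⟩]; exact hE₀ _ (by positivity) _ _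
    · simp [E, h]
  · intro p hp q hq
    rw [hEQ 0 ⟨p, hp⟩ ⟨q, hq⟩]
    simp [E₀, Matrix.one_apply]
  · intro p hp q hq s
    have h1 := (hentry ⟨p, hp⟩ ⟨q, hq⟩ _ _ (hder2 (s ^ 2 / 2))).comp s (hhalf s)
    refine (h1.congr_deriv ?_).congr_of_eventuallyEq (Eventually.of_forall fun s => ?_)
    · rw [mul_comm, Matrix.mul_apply, ← Finset.sum_coe_sort Q]
      congr 1
      refine Finset.sum_congr rfl fun r _ => ?_
      rw [hEQ s r ⟨q, hq⟩]
      rfl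
    · exact hEQ s ⟨p, hp⟩ ⟨q, hq⟩
  · intro p q hq
    by_cases hp : p ∈ Q
    · exact h_int ⟨p, hp⟩ ⟨q, hq⟩
    · simp [hEQ' _ _ _ hp]
  · intro p
    by_cases hp : p ∈ Q
    · have hle := hφ1 p hp
      lift p to Q using hp
      have hd : ∀ s ∈ Set.Ici (0:ℝ), HasDerivAt (fun s => v p (s ^ 2 / 2)) (v' p (s ^ 2 / 2) * s) s :=
        fun s _ => (hv p _).comp s (hhalf s)
      have hi : IntegrableOn (fun s => v' p (s ^ 2 / 2) * s) (Set.Ioi 0) := by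
        have : (fun s => v' p (s ^ 2 / 2) * s) =
            fun s => ∑ r : Q, (s * E s p r) * ∑ q : Q, a r q * φ q := by
          ext s
          simp only [v', hEQ, Finset.sum_mul]
          exact Finset.sum_congr rfl fun _ _ => by ring
        rw [this]
        exact integrable_finsetSum _ fun r _ => (h_int p r).mul_const _
      have ht : Tendsto (fun s => v p (s ^ 2 / 2)) atTop (𝓝 0) := by
        refine squeeze_zero (g := fun s => Real.exp (-8 * (s ^ 2 / 2)) * φ p) (fun s => ?_)
          (fun s => hdecay p _ (by positivity)) ?_
        · exact Finset.sum_nonneg fun r _ => mul_nonneg (hE₀ _ (by positivity) p r) (hφ0 r r.2).le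
        · simpa using (hexp.comp hsq).mul_const (φ p)
      have hI := integral_Ioi_of_hasDerivAt_of_tendsto' hd hi ht
      have h0 : v p ((0 : ℝ) ^ 2 / 2) = φ p := by simpa using hv0 p
      rw [h0] at hI
      have hmono : ∫ s in Set.Ioi (0 : ℝ), ∑ q ∈ Q, s * E s p q
          ≤ ∫ s in Set.Ioi (0 : ℝ), -(v' p (s ^ 2 / 2) * s) := by
        refine setIntegral_mono_on (integrable_finsetSum _ fun q hq => h_int p ⟨q, hq⟩) hi.neg
          measurableSet_Ioi fun s hs => ?_
        have hs0 : (0 : ℝ) ≤ s := le_of_lt hs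
        have h1 := mul_le_mul_of_nonneg_right (hv'le p (s ^ 2 / 2) (by positivity)) hs0
        have h2 : ∑ q ∈ Q, s * E s p q = (∑ r : Q, E₀ (s ^ 2 / 2) p r) * s := by
          rw [← Finset.sum_coe_sort Q, Finset.sum_mul]
          exact Finset.sum_congr rfl fun r _ => by rw [hEQ, mul_comm]
        rw [h2]
        linarith
      rw [integral_neg, hI] at hmono
      linarith
    · simp [hEQ' _ _ _ hp]
  · intro p q hq
    by_cases hp : p ∈ Q
    · lift p to Q using hp
      lift q to Q using hq
      refine squeeze_zero (g := fun s => Real.exp (-8 * (s ^ 2 / 2)) * (φ p / φ q))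
        (fun s => ?_) (fun s => ?_) ?_
      · rw [hEQ]; exact hE₀ _ (by positivity) _ _
      · rw [hEQ]; exact hEle p q _ (by positivity)
      · simpa using (hexp.comp hsq).mul_const (φ p / φ q)
    · simp [hEQ' _ _ _ hp]

end Kernel

end MetzlerKernel

section DiscreteLaplacian

open MeasureTheory Filter Topology

theorem hmesh_pos (d : ℕ) (lvl : Fin d → ℕ) (k : Fin d) : 0 < hmesh d lvl k := by
  unfold hmesh; positivity

theorem two_pow_mul_hmesh (d : ℕ) (lvl : Fin d → ℕ) (k : Fin d) :
    (2 : ℝ) ^ lvl k * hmesh d lvl k = 1 := by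
  unfold hmesh; exact mul_inv_cancel₀ (by positivity)

/-- The interior nodes of the grid in the directions `J`; the other indices are zero. -/
def gridNodes {d : ℕ} (J : Finset (Fin d)) (lvl : Fin d → ℕ) : Finset (Fin d → ℕ) :=
  Fintype.piFinset fun k => if k ∈ J then Finset.Ioo 0 (2 ^ lvl k) else {0}

theorem mem_gridNodes {d : ℕ} {J : Finset (Fin d)} {lvl : Fin d → ℕ} {p : Fin d → ℕ} :
    p ∈ gridNodes J lvl ↔
      (∀ j ∈ J, 0 < p j ∧ p j < 2 ^ lvl j) ∧ ∀ j, j ∉ J → p j = 0 := by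
  simp only [gridNodes, Fintype.mem_piFinset]
  constructor
  · intro h
    refine ⟨fun j hj => ?_, fun j hj => ?_⟩
    · simpa [hj] using h j
    · simpa [hj] using h j
  · rintro ⟨h1, h2⟩ j
    by_cases hj : j ∈ J
    · simpa [hj] using h1 j hj
    · simpa [hj] using h2 j hj

/-- The matrix of the central second difference operator in the directions `J`. -/
noncomputable def stencil {d : ℕ} (J : Finset (Fin d)) (lvl : Fin d → ℕ) (p q : Fin d → ℕ) : ℝ :=
  ∑ j ∈ J, ((if q = Function.update p j (p j + 1) then 1 else 0)
    - 2 * (if q = p then 1 else 0)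
    + (if q = Function.update p j (p j - 1) then 1 else 0)) / hmesh d lvl j ^ 2

theorem sum_stencil_mul {d : ℕ} {J : Finset (Fin d)} {lvl : Fin d → ℕ} {v : (Fin d → ℕ) → ℝ}
    (hv : ∀ q, q ∉ gridNodes J lvl → v q = 0) (p : Fin d → ℕ) :
    ∑ q ∈ gridNodes J lvl, stencil J lvl p q * v q =
      ∑ j ∈ J, (v (Function.update p j (p j + 1)) - 2 * v p + v (Function.update p j (p j - 1)))
        / hmesh d lvl j ^ 2 := by
  have key : ∀ r, ∑ q ∈ gridNodes J lvl, (if q = r then 1 else 0) * v q = v r := by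
    intro r
    by_cases hr : r ∈ gridNodes J lvl
    · simp [hr]
    · simp [hr, hv r hr]
  simp only [stencil, Finset.sum_mul]
  rw [Finset.sum_comm]
  refine Finset.sum_congr rfl fun j _ => ?_
  rw [← key (Function.update p j (p j + 1)), ← key p, ← key (Function.update p j (p j - 1)),
    Finset.mul_sum, ← Finset.sum_sub_distrib, ← Finset.sum_add_distrib, Finset.sum_div]
  exact Finset.sum_congr rfl fun _ _ => by ring

theorem stencil_nonneg {d : ℕ} {J : Finset (Fin d)} {lvl : Fin d → ℕ} {p q : Fin d → ℕ}
    (h : p ≠ q) : 0 ≤ stencil J lvl p q := by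
  refine Finset.sum_nonneg fun j _ => ?_
  rw [if_neg h.symm]
  have : ∀ P : Prop, [Decidable P] → (0 : ℝ) ≤ if P then 1 else 0 := by
    intro P _; split_ifs <;> norm_num
  have h1 := this (q = Function.update p j (p j + 1))
  have h2 := this (q = Function.update p j (p j - 1))
  exact div_nonneg (by linarith) (sq_nonneg _)

theorem exists_supersolution_stencil {d : ℕ} {J : Finset (Fin d)} (hJ : J.Nonempty)
    (lvl : Fin d → ℕ) :
    ∃ φ : (Fin d → ℕ) → ℝ, (∀ p ∈ gridNodes J lvl, 0 < φ p) ∧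
      (∀ p ∈ gridNodes J lvl, φ p ≤ 1 / 8) ∧
      ∀ p ∈ gridNodes J lvl, ∑ q ∈ gridNodes J lvl, stencil J lvl p q * φ q ≤ -1 := by
  obtain ⟨i, hi⟩ := hJ
  let ψ : ℕ → ℝ := fun n => (n * hmesh d lvl i) * (1 - n * hmesh d lvl i) / 2
  have hpos : ∀ p ∈ gridNodes J lvl, 0 < ψ (p i) := by
    intro p hp
    obtain ⟨h1, h2⟩ := (mem_gridNodes.1 hp).1 i hi
    have h3 : (0 : ℝ) < p i := by exact_mod_cast h1
    have h4 : (p i : ℝ) < 2 ^ lvl i := by exact_mod_cast h2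
    have h5 := mul_lt_mul_of_pos_right h4 (hmesh_pos d lvl i)
    rw [two_pow_mul_hmesh] at h5
    have h6 := mul_pos h3 (hmesh_pos d lvl i)
    have : 0 < 1 - p i * hmesh d lvl i := by linarith
    positivity
  let v : (Fin d → ℕ) → ℝ := fun q => if q ∈ gridNodes J lvl then ψ (q i) else 0
  have hv0 : ∀ q, 0 ≤ v q := by
    intro q
    by_cases hq : q ∈ gridNodes J lvl
    · simpa [v, hq] using (hpos q hq).le
    · simp [v, hq]
  have hupd : ∀ p ∈ gridNodes J lvl, ∀ j ∈ J, ∀ n,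
      (0 < n ∧ n < 2 ^ lvl j) → Function.update p j n ∈ gridNodes J lvl := by
    intro p hp j hj n hn
    rw [mem_gridNodes] at hp ⊢
    refine ⟨fun k hk => ?_, fun k hk => ?_⟩
    · by_cases h : k = j
      · subst h; simpa using hn
      · simpa [h] using hp.1 k hk
    · have : k ≠ j := fun h => hk (h ▸ hj)
      simpa [this] using hp.2 k hk
  have hvi : ∀ p ∈ gridNodes J lvl, ∀ n, n ≤ 2 ^ lvl i → v (Function.update p i n) = ψ n := by
    intro p hp n hn
    by_cases h : 0 < n ∧ n < 2 ^ lvl i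
    · simp [v, hupd p hp i hi n h]
    · have h' : Function.update p i n ∉ gridNodes J lvl := by
        intro hq
        have := (mem_gridNodes.1 hq).1 i hi
        rw [Function.update_self] at this
        exact h this
      have h2 : n = 0 ∨ n = 2 ^ lvl i := by omega
      rcases h2 with rfl | rfl
      · simp [v, h', ψ]
      · have := two_pow_mul_hmesh d lvl i
        simp [v, h', ψ, this]
  refine ⟨fun p => ψ (p i), hpos, fun p _ => ?_, fun p hp => ?_⟩
  · have := sq_nonneg ((p i : ℝ) * hmesh d lvl i - 1 / 2)
    simp only [ψ]
    nlinarith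
  · have h1 : ∑ q ∈ gridNodes J lvl, stencil J lvl p q * ψ (q i) =
        ∑ q ∈ gridNodes J lvl, stencil J lvl p q * v q :=
      Finset.sum_congr rfl fun q hq => by simp [v, hq]
    rw [h1, sum_stencil_mul (fun q hq => by simp [v, hq]), ← Finset.add_sum_erase _ _ hi]
    have hvp : v p = ψ (p i) := by simp [v, hp]
    obtain ⟨hp1, hp2⟩ := (mem_gridNodes.1 hp).1 i hi
    have h2 : (v (Function.update p i (p i + 1)) - 2 * v p + v (Function.update p i (p i - 1)))
        / hmesh d lvl i ^ 2 = -1 := by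
      rw [hvi p hp _ hp2, hvi p hp _ (by omega), hvp, div_eq_iff
        (pow_pos (hmesh_pos d lvl i) 2).ne']
      simp only [ψ]
      rw [Nat.cast_sub hp1]
      push_cast
      ring
    rw [h2]
    have h3 : ∑ j ∈ J.erase i, (v (Function.update p j (p j + 1)) - 2 * v p
        + v (Function.update p j (p j - 1))) / hmesh d lvl j ^ 2 ≤ 0 := by
      refine Finset.sum_nonpos fun j hj => ?_
      have hji := Finset.ne_of_mem_erase hj
      have hle : ∀ n, v (Function.update p j n) ≤ v p := by
        intro n
        by_cases hq : Function.update p j n ∈ gridNodes J lvl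
        · rw [hvp]
          simp [v, hq, hji.symm]
        · have : v (Function.update p j n) = 0 := by simp [v, hq]
          rw [this]; exact hv0 p
      have := hle (p j + 1)
      have := hle (p j - 1)
      exact div_nonpos_of_nonpos_of_nonneg (by linarith) (sq_nonneg _)
    linarith

/-- The maximum principle: a matrix with nonnegative off-diagonal entries and a positive strict
supersolution is injective. -/
theorem nonpos_of_sum_mul_eq_zero {X : Type*} {Q : Finset X} {a : X → X → ℝ}
    (hoff : ∀ p ∈ Q, ∀ q ∈ Q, p ≠ q → 0 ≤ a p q) {φ : X → ℝ} (hφ : ∀ p ∈ Q, 0 < φ p)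
    (hAφ : ∀ p ∈ Q, ∑ q ∈ Q, a p q * φ q ≤ -1) {v : X → ℝ}
    (hv : ∀ p ∈ Q, ∑ q ∈ Q, a p q * v q = 0) : ∀ p ∈ Q, v p ≤ 0 := by
  intro p₀ hp₀
  obtain ⟨p, hp, hmax⟩ := Q.exists_max_image (fun p => v p / φ p) ⟨p₀, hp₀⟩
  by_contra! hpos
  have hM : 0 < v p / φ p := (div_pos hpos (hφ _ hp₀)).trans_le (hmax _ hp₀)
  set M := v p / φ p with hMdef
  have hw : ∀ q ∈ Q, 0 ≤ a p q * (M * φ q - v q) := by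
    intro q hq
    by_cases h : p = q
    · subst h
      rw [hMdef, div_mul_cancel₀ _ (hφ p hp).ne', sub_self, mul_zero]
    · refine mul_nonneg (hoff p hp q hq h) ?_
      have := (div_le_iff₀ (hφ q hq)).1 (hmax q hq)
      linarith
  have h1 := Finset.sum_nonneg hw
  have h2 : ∑ q ∈ Q, a p q * (M * φ q - v q)
      = M * ∑ q ∈ Q, a p q * φ q - ∑ q ∈ Q, a p q * v q := by
    rw [Finset.mul_sum, ← Finset.sum_sub_distrib]
    exact Finset.sum_congr rfl fun _ _ => by ring
  rw [h2, hv p hp] at h1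
  have := mul_le_mul_of_nonneg_left (hAφ p hp) hM.le
  linarith

/-- Uniqueness for the discrete Poisson problem. -/
theorem eq_zero_of_discrete_harmonic {d : ℕ} (hd : 1 ≤ d) {lvl : Fin d → ℕ}
    {D : (Fin d → ℕ) → ℝ}
    (hb : ∀ i, IsGridIdx d lvl i → (∃ k, i k = 0 ∨ i k = 2 ^ lvl k) → D i = 0)
    (hD : ∀ i : Fin d → ℕ, (∀ k, 1 ≤ i k ∧ i k < 2 ^ lvl k) →
      ∑ k, (D (Function.update i k (i k + 1)) - 2 * D i + D (Function.update i k (i k - 1)))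
        / hmesh d lvl k ^ 2 = 0) :
    ∀ i, IsGridIdx d lvl i → D i = 0 := by
  have hne : (Finset.univ : Finset (Fin d)).Nonempty := ⟨⟨0, hd⟩, Finset.mem_univ _⟩
  obtain ⟨φ, h1, -, h3⟩ := exists_supersolution_stencil hne lvl
  set Q := gridNodes Finset.univ lvl with hQ
  have hmem : ∀ p, p ∈ Q ↔ ∀ k, 1 ≤ p k ∧ p k < 2 ^ lvl k := by
    intro p
    rw [hQ, mem_gridNodes]
    simp [Nat.succ_le_iff]
  let v : (Fin d → ℕ) → ℝ := fun q => if q ∈ Q then D q else 0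
  have hvD : ∀ q, IsGridIdx d lvl q → v q = D q := by
    intro q hq
    by_cases h : q ∈ Q
    · simp [v, h]
    · rw [hmem] at h
      push Not at h
      obtain ⟨k, hk⟩ := h
      have hk' : q k = 0 ∨ q k = 2 ^ lvl k := by
        have := hq k
        by_cases h0 : 1 ≤ q k
        · have := hk h0
          omega
        · omega
      have : q ∉ Q := by
        rw [hmem]
        intro h
        have := h k
        omega
      rw [hb q hq ⟨k, hk'⟩]
      simp [v, this]
  have hupd : ∀ p ∈ Q, ∀ k n, n ≤ 2 ^ lvl k → IsGridIdx d lvl (Function.update p k n) := by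
    intro p hp k n hn j
    by_cases h : j = k
    · subst h; simpa using hn
    · simpa [h] using ((hmem p).1 hp j).2.le
  have hv : ∀ p ∈ Q, ∑ q ∈ Q, stencil Finset.univ lvl p q * v q = 0 := by
    intro p hp
    rw [sum_stencil_mul (v := v) (fun q hq => if_neg hq), ← hD p ((hmem p).1 hp)]
    refine Finset.sum_congr rfl fun k _ => ?_
    have h4 := (hmem p).1 hp k
    rw [hvD _ (hupd p hp k (p k + 1) h4.2), hvD _ (hupd p hp k _ (by omega)),
      hvD p (fun k => ((hmem p).1 hp k).2.le)]
  have h5 := nonpos_of_sum_mul_eq_zero (fun p _ q _ h => stencil_nonneg h) h1 h3 hv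
  have h6 := nonpos_of_sum_mul_eq_zero (fun p _ q _ h => stencil_nonneg h) h1 h3
    (v := fun q => -v q) (fun p hp => by
      simp only [mul_neg, Finset.sum_neg_distrib, hv p hp, neg_zero])
  intro i hi
  rw [← hvD i hi]
  by_cases h : i ∈ Q
  · have := h5 i h
    have := h6 i h
    linarith
  · simp [v, h]

end DiscreteLaplacian

section Jets

open MeasureTheory Filter Topology

section WeightedIntegral

variable {X : Type*} {Q : Finset X} {κ : X → ℝ → ℝ} {C : ℝ}

theorem integrableOn_sum_mul {F : X → ℝ → ℝ} (hκ : ∀ q ∈ Q, IntegrableOn (κ q) (Set.Ioi 0))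
    (hF : ∀ q ∈ Q, Continuous (F q)) (hC : ∀ q ∈ Q, ∀ s, |F q s| ≤ C) :
    IntegrableOn (fun s => ∑ q ∈ Q, κ q s * F q s) (Set.Ioi 0) := by
  refine integrable_finsetSum _ fun q hq => ?_
  exact (hκ q hq).mul_bdd (c := C) (hF q hq).aestronglyMeasurable
    (ae_of_all _ fun s => by simpa using hC q hq s)

theorem abs_integral_sum_mul_le {F : X → ℝ → ℝ} (hκ : ∀ q ∈ Q, IntegrableOn (κ q) (Set.Ioi 0))
    (hκ0 : ∀ q ∈ Q, ∀ s, 0 < s → 0 ≤ κ q s) (hC : ∀ q ∈ Q, ∀ s, |F q s| ≤ C) :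
    |∫ s in Set.Ioi (0 : ℝ), ∑ q ∈ Q, κ q s * F q s|
      ≤ C * ∫ s in Set.Ioi (0 : ℝ), ∑ q ∈ Q, κ q s := by
  rw [← integral_const_mul, ← Real.norm_eq_abs]
  refine norm_integral_le_of_norm_le ((integrable_finsetSum _ hκ).const_mul C)
    ((ae_restrict_iff' measurableSet_Ioi).2 (ae_of_all _ fun s hs => ?_))
  rw [Finset.mul_sum]
  refine (norm_sum_le _ _).trans (Finset.sum_le_sum fun q hq => ?_)
  rw [norm_mul, Real.norm_eq_abs, Real.norm_eq_abs, abs_of_nonneg (hκ0 q hq s hs), mul_comm]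
  exact mul_le_mul_of_nonneg_right (hC q hq s) (hκ0 q hq s hs)

theorem norm_sum_mul_le {F : X → ℝ → ℝ} (hC : ∀ q ∈ Q, ∀ s, |F q s| ≤ C) (s : ℝ) :
    ‖∑ q ∈ Q, κ q s * F q s‖ ≤ ∑ q ∈ Q, ‖κ q s‖ * C := by
  refine (norm_sum_le _ _).trans (Finset.sum_le_sum fun q hq => ?_)
  rw [norm_mul]
  exact mul_le_mul_of_nonneg_left (hC q hq s) (norm_nonneg _)

theorem continuous_integral_sum_mul {Y : Type*} [TopologicalSpace Y] [FirstCountableTopology Y]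
    {F : X → Y → ℝ → ℝ} (hκ : ∀ q ∈ Q, IntegrableOn (κ q) (Set.Ioi 0))
    (hF : ∀ q ∈ Q, Continuous fun p : ℝ × Y => F q p.2 p.1)
    (hC : ∀ q ∈ Q, ∀ y s, |F q y s| ≤ C) :
    Continuous fun y => ∫ s in Set.Ioi (0 : ℝ), ∑ q ∈ Q, κ q s * F q y s := by
  refine continuous_of_dominated (bound := fun s => ∑ q ∈ Q, ‖κ q s‖ * C) (fun y => ?_)
    (fun y => ae_of_all _ fun s => norm_sum_mul_le (fun q hq => hC q hq y) s)
    (integrable_finsetSum _ fun q hq => (hκ q hq).norm.mul_const C)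
    (ae_of_all _ fun s => ?_)
  · refine (integrableOn_sum_mul hκ (fun q hq => ?_) fun q hq => hC q hq y).aestronglyMeasurable
    exact (hF q hq).comp (by fun_prop : Continuous fun s : ℝ => (s, y))
  · refine continuous_finsetSum _ fun q hq => continuous_const.mul ?_
    exact (hF q hq).comp (by fun_prop : Continuous fun y : Y => (s, y))

theorem hasDerivAt_integral_sum_mul {F F' : X → ℝ → ℝ → ℝ}
    (hκ : ∀ q ∈ Q, IntegrableOn (κ q) (Set.Ioi 0))
    (hF : ∀ q ∈ Q, ∀ t, Continuous (F q t)) (hF' : ∀ q ∈ Q, ∀ t, Continuous (F' q t))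
    (hC : ∀ q ∈ Q, ∀ t s, |F q t s| ≤ C) (hC' : ∀ q ∈ Q, ∀ t s, |F' q t s| ≤ C)
    (h : ∀ q ∈ Q, ∀ t s, HasDerivAt (fun t => F q t s) (F' q t s) t) (t : ℝ) :
    HasDerivAt (fun t => ∫ s in Set.Ioi (0 : ℝ), ∑ q ∈ Q, κ q s * F q t s)
      (∫ s in Set.Ioi (0 : ℝ), ∑ q ∈ Q, κ q s * F' q t s) t := by
  refine (hasDerivAt_integral_of_dominated_loc_of_deriv_le
    (F := fun t s => ∑ q ∈ Q, κ q s * F q t s) (F' := fun t s => ∑ q ∈ Q, κ q s * F' q t s)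
    (bound := fun s => ∑ q ∈ Q, ‖κ q s‖ * C) (s := Set.univ) (x₀ := t)
    univ_mem (Eventually.of_forall fun t => ?_) ?_ ?_ ?_ ?_ ?_).2
  · exact (integrableOn_sum_mul hκ (fun q hq => hF q hq t) fun q hq => hC q hq t).aestronglyMeasurable
  · exact integrableOn_sum_mul hκ (fun q hq => hF q hq t) fun q hq => hC q hq t
  · exact (integrableOn_sum_mul hκ (fun q hq => hF' q hq t)
      fun q hq => hC' q hq t).aestronglyMeasurable
  · exact ae_of_all _ fun s t _ => norm_sum_mul_le (fun q hq => hC' q hq t) s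
  · exact integrable_finsetSum _ fun q hq => (hκ q hq).norm.mul_const C
  · exact ae_of_all _ fun s t _ => HasDerivAt.fun_sum fun q hq => (h q hq t s).const_mul _

end WeightedIntegral

section Jet

variable {d : ℕ}

/-- The union of the hyperplanes spanned by the grid of level `lvl` in the directions `J`,
without any restriction on the remaining coordinates. -/
def gridPlanes (J : Finset (Fin d)) (lvl : Fin d → ℕ) : Set (Fin d → ℝ) :=
  {x | ∀ j ∈ J, ∃ m : ℕ, m ≤ 2 ^ lvl j ∧ x j = m * hmesh d lvl j}

/-- Orders of differentiation of at most four that vanish in the directions `J`. -/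
def JetIndex (J : Finset (Fin d)) (β : Fin d → ℕ) : Prop :=
  (∀ k, β k ≤ 4) ∧ ∀ j ∈ J, β j = 0

/-- A compatible family of derivatives on `gridPlanes J lvl` of a function that is odd with
respect to the hyperplanes `x k = 0` and `x k = 1`, `k ∉ J`; the derivatives of orders in
`{0, 4}` are bounded by `M`. -/
structure IsOddJet (J : Finset (Fin d)) (lvl : Fin d → ℕ)
    (W : (Fin d → ℕ) → (Fin d → ℝ) → ℝ) (M : ℝ) : Prop where
  deriv : ∀ β, JetIndex J β → ∀ k, k ∉ J → β k < 4 → ∀ x ∈ gridPlanes J lvl,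
    HasDerivAt (fun t => W β (Function.update x k t))
      (W (Function.update β k (β k + 1)) x) (x k)
  cont : ∀ β, JetIndex J β → ContinuousOn (W β) (gridPlanes J lvl)
  bdd : ∃ C, ∀ β, JetIndex J β → ∀ x ∈ gridPlanes J lvl, |W β x| ≤ C
  odd : ∀ β, JetIndex J β → ∀ k, k ∉ J → β k = 0 → ∀ x ∈ gridPlanes J lvl, ∀ b : ℝ,
    b = 0 ∨ b = 2 → W β (Function.update x k (b - x k)) = -W β x
  bound : ∀ α, JetIndex J α → (∀ k, α k = 0 ∨ α k = 4) → ∀ x ∈ gridPlanes J lvl, |W α x| ≤ M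

variable {J : Finset (Fin d)} {lvl : Fin d → ℕ}

theorem JetIndex.zero : JetIndex J 0 := ⟨fun _ => by simp, fun _ _ => rfl⟩

theorem JetIndex.update {β : Fin d → ℕ} (h : JetIndex J β) {k : Fin d} (hk : k ∉ J) {n : ℕ}
    (hn : n ≤ 4) : JetIndex J (Function.update β k n) := by
  refine ⟨fun i => ?_, fun j hj => ?_⟩
  · by_cases hi : i = k
    · subst hi; simpa using hn
    · simpa [hi] using h.1 i
  · have : j ≠ k := fun e => hk (e ▸ hj)
    simpa [this] using h.2 j hj

theorem update_mem_gridPlanes {x : Fin d → ℝ} (hx : x ∈ gridPlanes J lvl) {k : Fin d}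
    (hk : k ∉ J) (t : ℝ) : Function.update x k t ∈ gridPlanes J lvl := by
  intro j hj
  have : j ≠ k := fun e => hk (e ▸ hj)
  simpa [this] using hx j hj

/-- The index of a point of `gridPlanes J lvl` in the directions `J`. -/
noncomputable def planeIdx (J : Finset (Fin d)) (lvl : Fin d → ℕ) (x : Fin d → ℝ) : Fin d → ℕ :=
  fun k => if k ∈ J then ⌊x k * 2 ^ lvl k⌋₊ else 0

/-- The point with the coordinates prescribed by the index `q` in the directions `J`. -/
noncomputable def planePaste (J : Finset (Fin d)) (lvl : Fin d → ℕ) (q : Fin d → ℕ)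
    (x : Fin d → ℝ) : Fin d → ℝ :=
  fun k => if k ∈ J then q k * hmesh d lvl k else x k

theorem planeIdx_eq {x : Fin d → ℝ} {j : Fin d} (hj : j ∈ J) {m : ℕ}
    (hm : x j = m * hmesh d lvl j) : planeIdx J lvl x j = m := by
  simp only [planeIdx, hj, if_true]
  rw [hm, mul_assoc, mul_comm (hmesh d lvl j), two_pow_mul_hmesh, mul_one, Nat.floor_natCast]

theorem planeIdx_mul {x : Fin d → ℝ} (hx : x ∈ gridPlanes J lvl) {j : Fin d} (hj : j ∈ J) :
    x j = planeIdx J lvl x j * hmesh d lvl j := by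
  obtain ⟨m, -, hm⟩ := hx j hj
  rw [planeIdx_eq hj hm, hm]

theorem planeIdx_update {x : Fin d → ℝ} {k : Fin d} (hk : k ∉ J) (t : ℝ) :
    planeIdx J lvl (Function.update x k t) = planeIdx J lvl x := by
  ext j
  by_cases hj : j ∈ J
  · have : j ≠ k := fun e => hk (e ▸ hj)
    simp [planeIdx, this]
  · simp [planeIdx, hj]

theorem planePaste_planeIdx {x : Fin d → ℝ} (hx : x ∈ gridPlanes J lvl) :
    planePaste J lvl (planeIdx J lvl x) x = x := by
  ext k
  by_cases hk : k ∈ J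
  · simp only [planePaste, hk, if_true]
    exact (planeIdx_mul hx hk).symm
  · simp [planePaste, hk]

theorem planePaste_mem {q : Fin d → ℕ} (hq : q ∈ gridNodes J lvl) (x : Fin d → ℝ) :
    planePaste J lvl q x ∈ gridPlanes J lvl := fun j hj =>
  ⟨q j, ((mem_gridNodes.1 hq).1 j hj).2.le, by simp [planePaste, hj]⟩

theorem planePaste_update_of_mem {q : Fin d → ℕ} {k : Fin d} (hk : k ∈ J) (x : Fin d → ℝ) (t : ℝ) :
    planePaste J lvl q (Function.update x k t) = planePaste J lvl q x := by
  ext j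
  by_cases hj : j ∈ J
  · simp [planePaste, hj]
  · have : j ≠ k := fun e => hj (e ▸ hk)
    simp [planePaste, hj, this]

theorem planePaste_update {q : Fin d → ℕ} {k : Fin d} (hk : k ∉ J) (x : Fin d → ℝ) (t : ℝ) :
    planePaste J lvl q (Function.update x k t) = Function.update (planePaste J lvl q x) k t := by
  ext j
  by_cases hjk : j = k
  · subst hjk; simp [planePaste, hk]
  · simp [planePaste, hjk]

theorem planePaste_apply {q : Fin d → ℕ} {k : Fin d} (hk : k ∉ J) (x : Fin d → ℝ) :
    planePaste J lvl q x k = x k := by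
  simp [planePaste, hk]

theorem continuous_planePaste (q : Fin d → ℕ) : Continuous (planePaste J lvl q) := by
  refine continuous_pi fun k => ?_
  by_cases hk : k ∈ J
  · simp only [planePaste, hk, if_true]; fun_prop
  · simp only [planePaste, hk, if_false]; fun_prop

theorem planeIdx_eventuallyEq {x : Fin d → ℝ} (hx : x ∈ gridPlanes J lvl) :
    ∀ᶠ y in 𝓝[gridPlanes J lvl] x, planeIdx J lvl y = planeIdx J lvl x := by
  have h1 : ∀ᶠ y in 𝓝 x, ∀ j ∈ J, |y j - x j| < hmesh d lvl j := by
    rw [Finset.eventually_all]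
    intro j _
    have : ContinuousAt (fun y : Fin d → ℝ => |y j - x j|) x :=
      ((continuous_apply j).sub continuous_const).abs.continuousAt
    refine this.eventually (gt_mem_nhds ?_)
    simpa using hmesh_pos d lvl j
  filter_upwards [h1.filter_mono nhdsWithin_le_nhds, self_mem_nhdsWithin] with y hy hyΛ
  ext j
  by_cases hj : j ∈ J
  · obtain ⟨m, -, hm⟩ := hx j hj
    obtain ⟨n, -, hn⟩ := hyΛ j hj
    rw [planeIdx_eq hj hm, planeIdx_eq hj hn]
    have h := hy j hj
    rw [hm, hn, ← sub_mul, abs_mul, abs_of_pos (hmesh_pos d lvl j)] at h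
    have h2 : |((n : ℤ) - (m : ℤ) : ℝ)| < 1 := by
      have := hmesh_pos d lvl j
      push_cast
      nlinarith
    have h3 : |(n : ℤ) - m| < 1 := by exact_mod_cast h2
    have := Int.abs_lt_one_iff.1 h3
    omega
  · simp [planeIdx, hj]

end Jet

end Jets

section Semidiscrete

open MeasureTheory Filter Topology

section Solution

variable {d : ℕ} {J : Finset (Fin d)} {lvl : Fin d → ℕ}

theorem IsOddJet.nonneg {W : (Fin d → ℕ) → (Fin d → ℝ) → ℝ} {M : ℝ} (h : IsOddJet J lvl W M) :
    0 ≤ M :=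
  (abs_nonneg _).trans (h.bound 0 JetIndex.zero (fun _ => Or.inl rfl) 0
    fun j _ => ⟨0, Nat.zero_le _, by simp⟩)

theorem planeIdx_update_of_mem {x : Fin d → ℝ} {j : Fin d} (hj : j ∈ J) (n : ℕ) :
    planeIdx J lvl (Function.update x j (n * hmesh d lvl j)) =
      Function.update (planeIdx J lvl x) j n := by
  ext k
  by_cases hk : k = j
  · subst hk
    rw [planeIdx_eq hj (Function.update_self ..), Function.update_self]
  · simp [planeIdx, hk]

/-- The solution operator of the semidiscrete Poisson problem that is discrete in the
directions `J` and continuous in the others. -/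
theorem exists_semidiscrete_solution (hJ : J.Nonempty) {G : (Fin d → ℕ) → (Fin d → ℝ) → ℝ}
    {N : ℝ} (hG : IsOddJet J lvl G N) :
    ∃ W, IsOddJet J lvl W (N / 8) ∧
      (∀ β, ∀ x ∈ gridPlanes J lvl, (∃ j ∈ J, x j = 0 ∨ x j = 1) → W β x = 0) ∧
      ∀ x ∈ gridPlanes J lvl, (∀ j ∈ J, 0 < x j ∧ x j < 1) →
        ∑ j ∈ J, (W 0 (Function.update x j (x j + hmesh d lvl j)) - 2 * W 0 x
          + W 0 (Function.update x j (x j - hmesh d lvl j))) / hmesh d lvl j ^ 2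
        + ∑ k ∈ Jᶜ, W (Function.update 0 k 2) x = G 0 x := by
  obtain ⟨φ, hφ0, hφ1, hAφ⟩ := exists_supersolution_stencil hJ lvl
  obtain ⟨E, hE0, hEQ, hEinit, hEder, hEint, hEle, hElim⟩ :=
    exists_kernel (gridNodes J lvl) (stencil J lvl) (fun p _ q _ h => stencil_nonneg h) φ
      hφ0 hφ1 hAφ
  obtain ⟨C, hC⟩ := hG.bdd
  have hC0 : 0 ≤ C := (abs_nonneg _).trans (hC 0 JetIndex.zero 0
    fun j _ => ⟨0, Nat.zero_le _, by simp⟩)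
  set Q := gridNodes J lvl with hQ
  let g : (Fin d → ℕ) → (Fin d → ℕ) → (Fin d → ℝ) → ℝ := fun q β x => G β (planePaste J lvl q x)
  have hgc : ∀ q ∈ Q, ∀ β, JetIndex J β → Continuous (g q β) := fun q hq β hβ =>
    (hG.cont β hβ).comp_continuous (continuous_planePaste q) (planePaste_mem hq)
  have hgC : ∀ q ∈ Q, ∀ β, JetIndex J β → ∀ x, |g q β x| ≤ C := fun q hq β hβ x =>
    hC β hβ _ (planePaste_mem hq x)
  have hgd : ∀ q ∈ Q, ∀ β, JetIndex J β → ∀ k, k ∉ J → β k < 4 → ∀ x,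
      HasDerivAt (fun t => g q β (Function.update x k t))
        (g q (Function.update β k (β k + 1)) x) (x k) := by
    intro q hq β hβ k hk hβk x
    have := hG.deriv β hβ k hk hβk _ (planePaste_mem hq x)
    rw [planePaste_apply hk] at this
    simpa only [g, planePaste_update hk] using this
  have hgconst : ∀ q β k, k ∈ J → ∀ x t, g q β (Function.update x k t) = g q β x := by
    intro q β k hk x t
    simp only [g, planePaste_update_of_mem hk]
  have hgodd : ∀ q ∈ Q, ∀ β, JetIndex J β → ∀ k, k ∉ J → β k = 0 → ∀ b : ℝ, b = 0 ∨ b = 2 → ∀ x,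
      g q β (Function.update x k (b - x k)) = -g q β x := by
    intro q hq β hβ k hk hβk b hb x
    have := hG.odd β hβ k hk hβk _ (planePaste_mem hq x) b hb
    rw [planePaste_apply hk] at this
    simpa only [g, planePaste_update hk] using this
  have hIc : ∀ q ∈ Q, ∀ β, JetIndex J β →
      Continuous fun p : ℝ × (Fin d → ℝ) => gaussAvg (g q β) p.1 p.2 := fun q hq β hβ =>
    continuous_gaussAvg (hgc q hq β hβ) (hgC q hq β hβ)
  have hIs : ∀ q ∈ Q, ∀ β, JetIndex J β → ∀ x, Continuous fun s => gaussAvg (g q β) s x :=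
    fun q hq β hβ x => (hIc q hq β hβ).comp (by fun_prop : Continuous fun s : ℝ => (s, x))
  have hIC : ∀ q ∈ Q, ∀ β, JetIndex J β → ∀ x s, |gaussAvg (g q β) s x| ≤ C :=
    fun q hq β hβ x s => abs_gaussAvg_le (hgC q hq β hβ) s x
  let S : (Fin d → ℕ) → (Fin d → ℕ) → (Fin d → ℝ) → ℝ := fun p β x =>
    ∫ s in Set.Ioi (0 : ℝ), ∑ q ∈ Q, (s * E s p q) * gaussAvg (g q β) s x
  let W : (Fin d → ℕ) → (Fin d → ℝ) → ℝ := fun β x => -S (planeIdx J lvl x) β x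
  have hSint : ∀ p β, JetIndex J β → ∀ x, IntegrableOn
      (fun s => ∑ q ∈ Q, (s * E s p q) * gaussAvg (g q β) s x) (Set.Ioi 0) := fun p β hβ x =>
    integrableOn_sum_mul (hEint p) (fun q hq => hIs q hq β hβ x) fun q hq => hIC q hq β hβ x
  have hWder : ∀ β, JetIndex J β → ∀ k, k ∉ J → β k < 4 → ∀ x ∈ gridPlanes J lvl,
      HasDerivAt (fun t => W β (Function.update x k t))
        (W (Function.update β k (β k + 1)) x) (x k) := by
    intro β hβ k hk hβk x _
    have hβ' : JetIndex J (Function.update β k (β k + 1)) := hβ.update hk hβk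
    have h := hasDerivAt_integral_sum_mul (Q := Q) (κ := fun q s => s * E s (planeIdx J lvl x) q)
      (F := fun q t s => gaussAvg (g q β) s (Function.update x k t))
      (F' := fun q t s => gaussAvg (g q (Function.update β k (β k + 1))) s (Function.update x k t))
      (C := C) (hEint _)
      (fun q hq t => hIs q hq β hβ _) (fun q hq t => hIs q hq _ hβ' _)
      (fun q hq t s => hIC q hq β hβ _ s) (fun q hq t s => hIC q hq _ hβ' _ s)
      (fun q hq t s => by
        have := hasDerivAt_gaussAvg_coord (hgc q hq β hβ) (hgC q hq β hβ) (hgc q hq _ hβ')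
          (hgC q hq _ hβ') k
          (fun y => hgd q hq β hβ k hk hβk y) s (Function.update x k t)
        simpa using this) (x k)
    simp only [Function.update_eq_self] at h
    simpa only [W, S, planeIdx_update hk] using h.fun_neg
  have hWcont : ∀ β, JetIndex J β → ContinuousOn (W β) (gridPlanes J lvl) := by
    intro β hβ x hx
    have h : Continuous (S (planeIdx J lvl x) β) :=
      continuous_integral_sum_mul (Q := Q) (κ := fun q s => s * E s (planeIdx J lvl x) q)
        (F := fun q y s => gaussAvg (g q β) s y) (hEint _)
        (fun q hq => hIc q hq β hβ) (fun q hq y s => hIC q hq β hβ y s)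
    refine h.neg.continuousWithinAt.congr_of_eventuallyEq ?_ rfl
    filter_upwards [planeIdx_eventuallyEq hx] with y hy
    simp only [W, hy, Pi.neg_apply]
  have hWle : ∀ M, 0 ≤ M → ∀ β x, (∀ q ∈ Q, ∀ s, |gaussAvg (g q β) s x| ≤ M) →
      |W β x| ≤ M / 8 := by
    intro M hM β x hMb
    simp only [W, abs_neg]
    refine (abs_integral_sum_mul_le (hEint _)
      (fun q _ s hs => mul_nonneg hs.le (hE0 s _ q)) hMb).trans ?_
    have := mul_le_mul_of_nonneg_left (hEle (planeIdx J lvl x)) hM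
    linarith
  refine ⟨W, ⟨hWder, hWcont, ⟨C / 8, fun β hβ x _ => ?_⟩, ?_, ?_⟩, ?_, ?_⟩
  · exact hWle C hC0 β x fun q hq s => hIC q hq β hβ x s
  · intro β hβ k hk hβk x _ b hb
    simp only [W, S, planeIdx_update hk, neg_neg, ← integral_neg, ← Finset.sum_neg_distrib]
    congr 1
    ext s
    refine Finset.sum_congr rfl fun q hq => ?_
    rw [gaussAvg_reflect (hgodd q hq β hβ k hk hβk b hb)]
    ring
  · intro α hα hα4 x _
    refine hWle N hG.nonneg α x fun q hq s => abs_gaussAvg_le (fun y => ?_) s x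
    exact hG.bound α hα hα4 _ (planePaste_mem hq y)
  · rintro β x hx ⟨j, hj, hxj⟩
    have hnot : planeIdx J lvl x ∉ Q := by
      intro hmem
      have h1 := (mem_gridNodes.1 hmem).1 j hj
      rcases hxj with h | h
      · have := planeIdx_eq (lvl := lvl) (x := x) hj (m := 0) (by simpa using h)
        omega
      · have := planeIdx_eq (lvl := lvl) (x := x) hj (m := 2 ^ lvl j)
          (by push_cast; rw [two_pow_mul_hmesh, h])
        omega
    simp [W, S, hEQ _ _ _ hnot]
  · intro x hx h_int
    set p := planeIdx J lvl x with hp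
    have hxp : ∀ j ∈ J, x j = p j * hmesh d lvl j := fun j hj => planeIdx_mul hx hj
    have hpos : ∀ j ∈ J, 0 < p j ∧ p j < 2 ^ lvl j := by
      intro j hj
      obtain ⟨h1, h2⟩ := h_int j hj
      rw [hxp j hj] at h1 h2
      have h3 := pos_of_mul_pos_left h1 (hmesh_pos d lvl j).le
      rw [← two_pow_mul_hmesh d lvl j] at h2
      have h4 := lt_of_mul_lt_mul_right h2 (hmesh_pos d lvl j).le
      exact ⟨by exact_mod_cast h3, by exact_mod_cast h4⟩
    have hpQ : p ∈ Q := mem_gridNodes.2 ⟨hpos, fun j hj => by simp [hp, planeIdx, hj]⟩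
    have hSx : ∀ p' β j t, j ∈ J → S p' β (Function.update x j t) = S p' β x := by
      intro p' β j t hj
      simp only [S, gaussAvg_update_of_const (hgconst _ β j hj)]
    have hplus : ∀ j ∈ J, W 0 (Function.update x j (x j + hmesh d lvl j)) =
        -S (Function.update p j (p j + 1)) 0 x := by
      intro j hj
      have : x j + hmesh d lvl j = ((p j + 1 : ℕ) : ℝ) * hmesh d lvl j := by
        rw [hxp j hj]; push_cast; ring
      rw [this]
      simp only [W, planeIdx_update_of_mem hj, hSx _ _ j _ hj]
      rw [← hp]
    have hminus : ∀ j ∈ J, W 0 (Function.update x j (x j - hmesh d lvl j)) =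
        -S (Function.update p j (p j - 1)) 0 x := by
      intro j hj
      have : x j - hmesh d lvl j = ((p j - 1 : ℕ) : ℝ) * hmesh d lvl j := by
        rw [hxp j hj, Nat.cast_sub (hpos j hj).1]; push_cast; ring
      rw [this]
      simp only [W, planeIdx_update_of_mem hj, hSx _ _ j _ hj]
      rw [← hp]
    have hdisc : ∑ j ∈ J, (W 0 (Function.update x j (x j + hmesh d lvl j)) - 2 * W 0 x
          + W 0 (Function.update x j (x j - hmesh d lvl j))) / hmesh d lvl j ^ 2
        = -∫ s in Set.Ioi (0 : ℝ), ∑ q ∈ Q,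
            (s * ∑ r ∈ Q, stencil J lvl p r * E s r q) * gaussAvg (g q 0) s x := by
      have h1 : ∀ s, ∑ q ∈ Q, (s * ∑ r ∈ Q, stencil J lvl p r * E s r q) * gaussAvg (g q 0) s x =
          ∑ j ∈ J, ((∑ q ∈ Q, (s * E s (Function.update p j (p j + 1)) q) * gaussAvg (g q 0) s x)
            - 2 * (∑ q ∈ Q, (s * E s p q) * gaussAvg (g q 0) s x)
            + ∑ q ∈ Q, (s * E s (Function.update p j (p j - 1)) q) * gaussAvg (g q 0) s x)
            / hmesh d lvl j ^ 2 := by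
        intro s
        simp only [Finset.mul_sum, ← Finset.sum_sub_distrib, ← Finset.sum_add_distrib,
          Finset.sum_div]
        rw [Finset.sum_comm]
        refine Finset.sum_congr rfl fun q _ => ?_
        rw [← Finset.mul_sum, sum_stencil_mul (v := fun r => E s r q) (fun r hr => hEQ s r q hr),
          Finset.mul_sum, Finset.sum_mul]
        exact Finset.sum_congr rfl fun j _ => by ring
      simp only [h1]
      rw [integral_finsetSum _ fun j _ => ?_, ← Finset.sum_neg_distrib]
      · refine Finset.sum_congr rfl fun j hj => ?_
        have i1 := hSint (Function.update p j (p j + 1)) 0 JetIndex.zero x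
        have i2 := hSint p 0 JetIndex.zero x
        have i3 := hSint (Function.update p j (p j - 1)) 0 JetIndex.zero x
        have i4 : IntegrableOn (fun s =>
            (∑ q ∈ Q, (s * E s (Function.update p j (p j + 1)) q) * gaussAvg (g q 0) s x)
            - 2 * ∑ q ∈ Q, (s * E s p q) * gaussAvg (g q 0) s x) (Set.Ioi 0) :=
          i1.sub (i2.const_mul 2)
        rw [integral_div, integral_add i4 i3,
          integral_sub i1 (i2.const_mul 2), integral_const_mul, hplus j hj, hminus j hj]
        simp only [W, S, ← hp]
        ring
      · have i1 := hSint (Function.update p j (p j + 1)) 0 JetIndex.zero x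
        have i2 := hSint p 0 JetIndex.zero x
        have i3 := hSint (Function.update p j (p j - 1)) 0 JetIndex.zero x
        exact ((i1.sub (i2.const_mul 2)).add i3).div_const _
    have hu : ∀ k ∈ Jᶜ, ∀ n ≤ 4, JetIndex J (Function.update (0 : Fin d → ℕ) k n) := fun k hk n hn =>
      JetIndex.zero.update (Finset.mem_compl.1 hk) hn
    have hlap : ∑ k ∈ Jᶜ, W (Function.update 0 k 2) x = -∫ s in Set.Ioi (0 : ℝ),
        ∑ k ∈ Jᶜ, ∑ q ∈ Q, (s * E s p q) * gaussAvg (g q (Function.update 0 k 2)) s x := by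
      rw [integral_finsetSum _ fun k hk => hSint p _ (hu k hk 2 (by norm_num)) x,
        ← Finset.sum_neg_distrib]
    have hder : ∀ s, HasDerivAt (fun s => ∑ q ∈ Q, E s p q * gaussAvg (g q 0) s x)
        (∑ q ∈ Q, (s * ∑ r ∈ Q, stencil J lvl p r * E s r q) * gaussAvg (g q 0) s x
          + ∑ k ∈ Jᶜ, ∑ q ∈ Q, (s * E s p q) * gaussAvg (g q (Function.update 0 k 2)) s x) s := by
      intro s
      have hg : ∀ q ∈ Q, HasDerivAt (fun s => gaussAvg (g q 0) s x)
          (s * ∑ k ∈ Jᶜ, gaussAvg (g q (Function.update 0 k 2)) s x) s := by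
        intro q hq
        have key := hasDerivAt_gaussAvg_scale (g := g q 0) (C := C)
          (g₁ := fun k => if k ∈ J then fun _ => 0 else g q (Function.update 0 k 1))
          (g₂ := fun k => if k ∈ J then fun _ => 0 else g q (Function.update 0 k 2))
          (hgc q hq 0 JetIndex.zero) (hgC q hq 0 JetIndex.zero)
          (fun k => by
            split_ifs with h
            · fun_prop
            · exact hgc q hq _ (hu k (Finset.mem_compl.2 h) 1 (by norm_num)))
          (fun k => by
            split_ifs with h
            · simpa using hC0
            · exact hgC q hq _ (hu k (Finset.mem_compl.2 h) 1 (by norm_num)))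
          (fun k => by
            split_ifs with h
            · fun_prop
            · exact hgc q hq _ (hu k (Finset.mem_compl.2 h) 2 (by norm_num)))
          (fun k => by
            split_ifs with h
            · simpa using hC0
            · exact hgC q hq _ (hu k (Finset.mem_compl.2 h) 2 (by norm_num)))
          (fun k y => by
            split_ifs with h
            · simp only [hgconst q 0 k h]
              exact hasDerivAt_const _ _
            · exact hgd q hq 0 JetIndex.zero k h (by simp) y)
          (fun k y => by
            split_ifs with h
            · exact hasDerivAt_const _ _
            · have := hgd q hq _ (hu k (Finset.mem_compl.2 h) 1 (by norm_num)) k h (by simp) y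
              simpa using this) x s
        refine key.congr_deriv ?_
        congr 1
        rw [← Finset.sum_add_sum_compl J, Finset.sum_eq_zero, zero_add]
        · refine Finset.sum_congr rfl fun k hk => ?_
          rw [if_neg (Finset.mem_compl.1 hk)]
        · intro k hk
          simp [hk, gaussAvg]
      refine (HasDerivAt.fun_sum fun q hq => (hEder p hpQ q hq s).mul (hg q hq)).congr_deriv ?_
      rw [Finset.sum_comm (s := Jᶜ), ← Finset.sum_add_distrib]
      refine Finset.sum_congr rfl fun q _ => ?_
      rw [← Finset.mul_sum]
      ring
    have i1 : IntegrableOn (fun s => ∑ q ∈ Q, (s * ∑ r ∈ Q, stencil J lvl p r * E s r q)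
        * gaussAvg (g q 0) s x) (Set.Ioi 0) := by
      refine integrableOn_sum_mul (C := C) (fun q hq => ?_)
        (fun q hq => hIs q hq 0 JetIndex.zero x) (fun q hq => hIC q hq 0 JetIndex.zero x)
      have : (fun s => s * ∑ r ∈ Q, stencil J lvl p r * E s r q) =
          fun s => ∑ r ∈ Q, stencil J lvl p r * (s * E s r q) := by
        ext s
        rw [Finset.mul_sum]
        exact Finset.sum_congr rfl fun _ _ => by ring
      rw [this]
      exact integrable_finsetSum _ fun r _ => (hEint r q hq).const_mul _
    have i2 : IntegrableOn (fun s => ∑ k ∈ Jᶜ, ∑ q ∈ Q, (s * E s p q)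
        * gaussAvg (g q (Function.update 0 k 2)) s x) (Set.Ioi 0) :=
      integrable_finsetSum _ fun k hk => hSint p _ (hu k hk 2 (by norm_num)) x
    have hlim : Tendsto (fun s => ∑ q ∈ Q, E s p q * gaussAvg (g q 0) s x) atTop (𝓝 0) := by
      have hsum : ∑ _q ∈ Q, (0 : ℝ) = 0 := Finset.sum_const_zero
      refine hsum ▸ tendsto_finsetSum Q fun q hq => ?_
      refine squeeze_zero_norm (a := fun s => E s p q * C) (fun s => ?_) ?_
      · rw [norm_mul, Real.norm_eq_abs, Real.norm_eq_abs, abs_of_nonneg (hE0 s p q)]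
        exact mul_le_mul_of_nonneg_left (hIC q hq 0 JetIndex.zero x s) (hE0 s p q)
      · simpa using (hElim p q hq).mul_const C
    have hI := integral_Ioi_of_hasDerivAt_of_tendsto' (fun s _ => hder s) (i1.add i2) hlim
    rw [hdisc, hlap, ← neg_add, ← integral_add i1 i2, hI, zero_sub, neg_neg]
    rw [Finset.sum_eq_single p]
    · rw [hEinit p hpQ p hpQ, if_pos rfl, one_mul, gaussAvg_zero]
      simp only [g, hp, planePaste_planeIdx hx]
    · intro q hq hqp
      rw [hEinit p hpQ q hq, if_neg hqp.symm, zero_mul]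
    · exact fun h => absurd hpQ h

end Solution

end Semidiscrete

section TruncationError

open MeasureTheory Filter Topology

theorem abs_le_pow_of_abs_deriv_le {g g' : ℝ → ℝ} {c : ℝ} (n : ℕ) (h0 : g 0 = 0)
    (hg : ∀ s, HasDerivAt g (g' s) s) (hb : ∀ s, 0 ≤ s → |g' s| ≤ c * s ^ n) {s : ℝ}
    (hs : 0 ≤ s) : |g s| ≤ c / (n + 1) * s ^ (n + 1) := by
  have hpow : ∀ s : ℝ, HasDerivAt (fun s => c / (n + 1) * s ^ (n + 1)) (c * s ^ n) s := by
    intro s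
    refine ((hasDerivAt_pow (n + 1) s).const_mul (c / (n + 1))).congr_deriv ?_
    have : (n : ℝ) + 1 ≠ 0 := by positivity
    push_cast
    field_simp
  have key : ∀ σ : ℝ, |σ| ≤ 1 → σ * g s ≤ c / (n + 1) * s ^ (n + 1) := by
    intro σ hσ
    have hd : ∀ s, HasDerivAt (fun s => c / (n + 1) * s ^ (n + 1) - σ * g s)
        (c * s ^ n - σ * g' s) s := fun s => (hpow s).sub ((hg s).const_mul σ)
    have hmono : MonotoneOn (fun s => c / (n + 1) * s ^ (n + 1) - σ * g s) (Set.Ici 0) := by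
      refine monotoneOn_of_hasDerivWithinAt_nonneg (convex_Ici 0)
        (fun t _ => (hd t).continuousAt.continuousWithinAt)
        (fun t _ => (hd t).hasDerivWithinAt) fun t ht => ?_
      rw [interior_Ici] at ht
      have h1 := hb t (le_of_lt ht)
      have h2 : σ * g' t ≤ |g' t| := by
        refine (le_abs_self _).trans ?_
        rw [abs_mul]
        exact mul_le_of_le_one_left (abs_nonneg _) hσ
      linarith
    have := hmono (Set.mem_Ici.2 le_rfl) (Set.mem_Ici.2 hs) hs
    simp only [h0] at this
    simpa using this
  have h1 := key 1 (by simp)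
  have h2 := key (-1) (by simp)
  exact abs_le.2 ⟨by linarith, by linarith⟩

/-- The truncation error of the central second difference. -/
theorem abs_second_difference_sub_le {p p₁ p₂ p₃ p₄ : ℝ → ℝ} {M : ℝ}
    (h₁ : ∀ t, HasDerivAt p (p₁ t) t) (h₂ : ∀ t, HasDerivAt p₁ (p₂ t) t)
    (h₃ : ∀ t, HasDerivAt p₂ (p₃ t) t) (h₄ : ∀ t, HasDerivAt p₃ (p₄ t) t)
    (hM : ∀ t, |p₄ t| ≤ M) (t : ℝ) {h : ℝ} (hh : 0 ≤ h) :
    |p (t + h) - 2 * p t + p (t - h) - h ^ 2 * p₂ t| ≤ M / 12 * h ^ 4 := by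
  have hp : ∀ {q q' : ℝ → ℝ}, (∀ t, HasDerivAt q (q' t) t) → ∀ s,
      HasDerivAt (fun s => q (t + s)) (q' (t + s)) s := fun hq s =>
    HasDerivAt.comp_const_add t s (hq (t + s))
  have hm : ∀ {q q' : ℝ → ℝ}, (∀ t, HasDerivAt q (q' t) t) → ∀ s,
      HasDerivAt (fun s => q (t - s)) (-q' (t - s)) s := fun hq s =>
    HasDerivAt.comp_const_sub t s (hq (t - s))
  have hsq : ∀ s : ℝ, HasDerivAt (fun s : ℝ => s ^ 2 * p₂ t) (2 * s * p₂ t) s := fun s => by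
    simpa using (hasDerivAt_pow 2 s).mul_const (p₂ t)
  have e1 := fun {s : ℝ} (hs : 0 ≤ s) => abs_le_pow_of_abs_deriv_le (c := 2 * M) 0
    (g := fun s => p₃ (t + s) - p₃ (t - s)) (g' := fun s => p₄ (t + s) + p₄ (t - s)) (by simp)
    (fun s => ((hp h₄ s).sub (hm h₄ s)).congr_deriv (by ring))
    (fun s _ => by
      have := abs_add_le (p₄ (t + s)) (p₄ (t - s))
      have := hM (t + s)
      have := hM (t - s)
      simp only [pow_zero]
      linarith) hs
  have e2 := fun {s : ℝ} (hs : 0 ≤ s) => abs_le_pow_of_abs_deriv_le 1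
    (g := fun s => p₂ (t + s) + p₂ (t - s) - 2 * p₂ t) (by simp; ring)
    (fun s => (((hp h₃ s).add (hm h₃ s)).sub_const _).congr_deriv (by ring))
    (fun s hs => e1 hs) hs
  have e3 := fun {s : ℝ} (hs : 0 ≤ s) => abs_le_pow_of_abs_deriv_le 2
    (g := fun s => p₁ (t + s) - p₁ (t - s) - 2 * s * p₂ t) (by simp)
    (fun s => (((hp h₂ s).sub (hm h₂ s)).sub
      (((hasDerivAt_id s).const_mul 2).mul_const (p₂ t))).congr_deriv (by simp))
    (fun s hs => e2 hs) hs
  have e4 := abs_le_pow_of_abs_deriv_le 3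
    (g := fun s => p (t + s) - 2 * p t + p (t - s) - s ^ 2 * p₂ t) (by simp; ring)
    (fun s => ((((hp h₁ s).sub_const _).add (hm h₁ s)).sub (hsq s)).congr_deriv (by ring))
    (fun s hs => e3 hs) hh
  refine e4.trans (le_of_eq ?_)
  push_cast
  ring

section Truncation

variable {d : ℕ} {J : Finset (Fin d)} {lvl : Fin d → ℕ}

/-- The truncation error of the central second difference in the direction `j`, divided by the
square of the mesh size. -/
noncomputable def truncJet (lvl : Fin d → ℕ) (j : Fin d) (W : (Fin d → ℕ) → (Fin d → ℝ) → ℝ) :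
    (Fin d → ℕ) → (Fin d → ℝ) → ℝ := fun β x =>
  ((W β (Function.update x j (x j + hmesh d lvl j)) - 2 * W β x
    + W β (Function.update x j (x j - hmesh d lvl j))) / hmesh d lvl j ^ 2
    - W (Function.update β j 2) x) / hmesh d lvl j ^ 2

theorem gridPlanes_anti {J' : Finset (Fin d)} (h : J' ⊆ J) :
    gridPlanes J lvl ⊆ gridPlanes J' lvl := fun _ hx j hj => hx j (h hj)

theorem JetIndex.mono {J' : Finset (Fin d)} (h : J' ⊆ J) {β : Fin d → ℕ} (hβ : JetIndex J β) :
    JetIndex J' β := ⟨hβ.1, fun j hj => hβ.2 j (h hj)⟩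

theorem IsOddJet.truncJet {j : Fin d} (hj : j ∈ J) {W : (Fin d → ℕ) → (Fin d → ℝ) → ℝ} {M : ℝ}
    (hW : IsOddJet (J.erase j) lvl W M) : IsOddJet J lvl (truncJet lvl j W) (M / 12) := by
  have hsub := Finset.erase_subset j J
  have hje : j ∉ J.erase j := Finset.notMem_erase j J
  have hh := hmesh_pos d lvl j
  have hmem : ∀ x ∈ gridPlanes J lvl, ∀ t, Function.update x j t ∈ gridPlanes (J.erase j) lvl :=
    fun x hx t => update_mem_gridPlanes (gridPlanes_anti hsub hx) hje t
  have hidx2 : ∀ β, JetIndex J β → JetIndex (J.erase j) (Function.update β j 2) := fun β hβ =>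
    (hβ.mono hsub).update hje (by norm_num)
  have hkj : ∀ k, k ∉ J → k ≠ j := fun k hk e => hk (e ▸ hj)
  have hke : ∀ k, k ∉ J → k ∉ J.erase j := fun k hk h => hk (hsub h)
  refine ⟨?_, ?_, ?_, ?_, ?_⟩
  · intro β hβ k hk hβk x hx
    have h1 := hW.deriv β (hβ.mono hsub) k (hke k hk) hβk
    have hd : ∀ c, HasDerivAt (fun t => W β (Function.update (Function.update x k t) j (x j + c)))
        (W (Function.update β k (β k + 1)) (Function.update x j (x j + c))) (x k) := by
      intro c
      have := h1 _ (hmem x hx (x j + c))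
      rw [Function.update_of_ne (hkj k hk)] at this
      simpa only [Function.update_comm (hkj k hk)] using this
    have h2 := hW.deriv _ (hidx2 β hβ) k (hke k hk)
      (by rwa [Function.update_of_ne (hkj k hk)]) x (gridPlanes_anti hsub hx)
    rw [Function.update_of_ne (hkj k hk), Function.update_comm (hkj k hk).symm] at h2
    have h3 := (((((hd (hmesh d lvl j)).sub ((h1 x (gridPlanes_anti hsub hx)).const_mul 2)).add
      (hd (-hmesh d lvl j))).div_const (hmesh d lvl j ^ 2)).sub h2).div_const (hmesh d lvl j ^ 2)
    refine (h3.congr_of_eventuallyEq (Eventually.of_forall fun t => ?_)).congr_deriv ?_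
    · simp only [_root_.truncJet, Function.update_of_ne (hkj k hk).symm, sub_eq_add_neg,
        Pi.add_apply, Pi.neg_apply]
    · simp only [_root_.truncJet, sub_eq_add_neg]
  · intro β hβ
    have hc := hW.cont β (hβ.mono hsub)
    have hd : ∀ c, ContinuousOn (fun x => W β (Function.update x j (x j + c)))
        (gridPlanes J lvl) := fun c =>
      hc.comp (by fun_prop : Continuous fun x : Fin d → ℝ =>
        Function.update x j (x j + c)).continuousOn fun x hx => hmem x hx _
    have h2 := (hW.cont _ (hidx2 β hβ)).mono (gridPlanes_anti (lvl := lvl) hsub)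
    exact (((((hd (hmesh d lvl j)).sub (continuousOn_const.mul
      (hc.mono (gridPlanes_anti hsub)))).add (hd (-hmesh d lvl j))).div_const _).sub h2).div_const _
  · obtain ⟨C, hC⟩ := hW.bdd
    refine ⟨((C + 2 * C + C) / hmesh d lvl j ^ 2 + C) / hmesh d lvl j ^ 2, fun β hβ x hx => ?_⟩
    have a1 := hC β (hβ.mono hsub) _ (hmem x hx (x j + hmesh d lvl j))
    have a2 := hC β (hβ.mono hsub) x (gridPlanes_anti hsub hx)
    have a3 := hC β (hβ.mono hsub) _ (hmem x hx (x j - hmesh d lvl j))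
    have a4 := hC _ (hidx2 β hβ) x (gridPlanes_anti hsub hx)
    have h2 : 0 < hmesh d lvl j ^ 2 := by positivity
    simp only [_root_.truncJet]
    rw [abs_div, abs_of_pos h2]
    gcongr
    refine (abs_sub _ _).trans (add_le_add ?_ a4)
    rw [abs_div, abs_of_pos h2]
    gcongr
    rw [abs_le] at a1 a2 a3 ⊢
    constructor <;> linarith [a1.1, a1.2, a2.1, a2.2, a3.1, a3.2]
  · intro β hβ k hk hβk x hx b hb
    have h1 := fun y hy => hW.odd β (hβ.mono hsub) k (hke k hk) hβk y hy b hb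
    have hd : ∀ t, W β (Function.update (Function.update x k (b - x k)) j t) =
        -W β (Function.update x j t) := by
      intro t
      have := h1 _ (hmem x hx t)
      rw [Function.update_of_ne (hkj k hk)] at this
      rwa [Function.update_comm (hkj k hk)]
    have h2 := hW.odd _ (hidx2 β hβ) k (hke k hk)
      (by rwa [Function.update_of_ne (hkj k hk)]) x (gridPlanes_anti hsub hx) b hb
    simp only [_root_.truncJet, Function.update_of_ne (hkj k hk).symm, hd, h2,
      h1 x (gridPlanes_anti hsub hx)]
    ring
  · intro α hα hα4 x hx
    have hαj := hα.2 j hj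
    have hd : ∀ n < 4, ∀ t, HasDerivAt
        (fun t => W (Function.update α j n) (Function.update x j t))
        (W (Function.update α j (n + 1)) (Function.update x j t)) t := by
      intro n hn t
      have := hW.deriv (Function.update α j n) ((hα.mono hsub).update hje (by omega)) j hje
        (by simpa using hn) _ (hmem x hx t)
      simpa using this
    have h0 : Function.update α j 0 = α := by rw [← hαj, Function.update_eq_self]
    have key := abs_second_difference_sub_le (M := M) (hd 0 (by norm_num)) (hd 1 (by norm_num))
      (hd 2 (by norm_num)) (hd 3 (by norm_num))
      (fun t => hW.bound _ ((hα.mono hsub).update hje le_rfl) (fun k => by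
        by_cases hk : k = j
        · subst hk; simp
        · simpa [hk] using hα4 k) _ (hmem x hx t)) (x j) hh.le
    simp only [h0, Function.update_eq_self, one_add_one_eq_two] at key
    have e : _root_.truncJet lvl j W α x =
        (W α (Function.update x j (x j + hmesh d lvl j)) - 2 * W α x
          + W α (Function.update x j (x j - hmesh d lvl j))
          - hmesh d lvl j ^ 2 * W (Function.update α j 2) x) / hmesh d lvl j ^ 4 := by
      simp only [_root_.truncJet]
      field_simp
    rw [e, abs_div, abs_of_pos (by positivity : 0 < hmesh d lvl j ^ 4),
      div_le_iff₀ (by positivity)]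
    exact key

theorem IsOddJet.neg_sum {ι : Type*} (T : Finset ι) {G : ι → (Fin d → ℕ) → (Fin d → ℝ) → ℝ}
    {M : ℝ} (hG : ∀ i ∈ T, IsOddJet J lvl (G i) M) :
    IsOddJet J lvl (fun β x => -∑ i ∈ T, G i β x) (T.card * M) := by
  refine ⟨?_, ?_, ?_, ?_, ?_⟩
  · intro β hβ k hk hβk x hx
    exact (HasDerivAt.fun_sum fun i hi => (hG i hi).deriv β hβ k hk hβk x hx).fun_neg
  · intro β hβ
    exact (continuousOn_finsetSum _ fun i hi => (hG i hi).cont β hβ).neg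
  · have hb : ∀ i, ∃ C, i ∈ T → ∀ β, JetIndex J β → ∀ x ∈ gridPlanes J lvl, |G i β x| ≤ C := by
      intro i
      by_cases hi : i ∈ T
      · obtain ⟨C, hC⟩ := (hG i hi).bdd
        exact ⟨C, fun _ => hC⟩
      · exact ⟨0, fun h => absurd h hi⟩
    choose C hC using hb
    refine ⟨∑ i ∈ T, C i, fun β hβ x hx => ?_⟩
    rw [abs_neg]
    exact (Finset.abs_sum_le_sum_abs _ _).trans (Finset.sum_le_sum fun i hi => hC i hi β hβ x hx)
  · intro β hβ k hk hβk x hx b hb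
    rw [neg_neg, ← Finset.sum_neg_distrib]
    refine Finset.sum_congr rfl fun i hi => ?_
    rw [(hG i hi).odd β hβ k hk hβk x hx b hb, neg_neg]
  · intro α hα hα4 x hx
    rw [abs_neg, ← nsmul_eq_mul]
    exact (Finset.abs_sum_le_sum_abs _ _).trans
      (Finset.sum_le_card_nsmul _ _ _ fun i hi => (hG i hi).bound α hα hα4 x hx)

end Truncation

end TruncationError

section Taylor

open MeasureTheory Filter Topology

/-- Symmetry of mixed partial derivatives on the unit square for functions vanishing on the axes:
only the existence and continuity of one of the mixed derivatives is assumed. -/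
theorem hasDerivWithinAt_swap {V Va Vb P : ℝ → ℝ → ℝ}
    (hP : ContinuousOn (fun p : ℝ × ℝ => P p.1 p.2) (Set.Icc 0 1 ×ˢ Set.Icc 0 1))
    (hV0 : ∀ a ∈ Set.Icc (0 : ℝ) 1, V a 0 = 0) (hVb0 : ∀ b ∈ Set.Icc (0 : ℝ) 1, Vb 0 b = 0)
    (hVa : ∀ a ∈ Set.Icc (0 : ℝ) 1, ∀ b ∈ Set.Icc (0 : ℝ) 1,
      HasDerivWithinAt (fun a => V a b) (Va a b) (Set.Icc 0 1) a)
    (hVb : ∀ a ∈ Set.Icc (0 : ℝ) 1, ∀ b ∈ Set.Icc (0 : ℝ) 1,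
      HasDerivWithinAt (fun b => V a b) (Vb a b) (Set.Icc 0 1) b)
    (hVba : ∀ a ∈ Set.Icc (0 : ℝ) 1, ∀ b ∈ Set.Icc (0 : ℝ) 1,
      HasDerivWithinAt (fun a => Vb a b) (P a b) (Set.Icc 0 1) a)
    {a b : ℝ} (ha : a ∈ Set.Icc (0 : ℝ) 1) (hb : b ∈ Set.Icc (0 : ℝ) 1) :
    HasDerivWithinAt (fun b => Va a b) (P a b) (Set.Icc 0 1) b := by
  set pr : ℝ → ℝ := fun t => Set.projIcc (0 : ℝ) 1 zero_le_one t with hpr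
  have hpr_eq : ∀ t ∈ Set.Icc (0 : ℝ) 1, pr t = t := fun t ht => by
    simp [hpr, Set.projIcc_of_mem _ ht]
  have hpr_mem : ∀ t, pr t ∈ Set.Icc (0 : ℝ) 1 := fun t => (Set.projIcc (0 : ℝ) 1 zero_le_one t).2
  have hprc : Continuous pr := continuous_subtype_val.comp continuous_projIcc
  set Q : ℝ → ℝ → ℝ := fun a b => P (pr a) (pr b) with hQ
  have hQc : Continuous (fun p : ℝ × ℝ => Q p.1 p.2) :=
    hP.comp_continuous (f := fun p : ℝ × ℝ => (pr p.1, pr p.2))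
      ((hprc.comp continuous_fst).prodMk (hprc.comp continuous_snd))
      fun p => ⟨hpr_mem _, hpr_mem _⟩
  have ftc : ∀ (g g' : ℝ → ℝ), Continuous g' → g 0 = 0 →
      (∀ t ∈ Set.Icc (0 : ℝ) 1, HasDerivWithinAt g (g' t) (Set.Icc 0 1) t) →
      ∀ t ∈ Set.Icc (0 : ℝ) 1, g t = ∫ s in (0 : ℝ)..t, g' s := by
    intro g g' hg' h0 hd t ht
    rw [intervalIntegral.integral_eq_sub_of_hasDerivAt_of_le (f := g) ht.1, h0, sub_zero]
    · exact fun s hs => ((hd s ⟨hs.1, hs.2.trans ht.2⟩).continuousWithinAt).mono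
        (Set.Icc_subset_Icc le_rfl ht.2)
    · exact fun s hs => (hd s ⟨hs.1.le, hs.2.le.trans ht.2⟩).hasDerivAt
        (Icc_mem_nhds hs.1 (hs.2.trans_le ht.2))
    · exact hg'.intervalIntegrable _ _
  have hQa : ∀ b, Continuous fun a => Q a b := fun b =>
    hQc.comp (by fun_prop : Continuous fun a : ℝ => (a, b))
  have hQb : ∀ a, Continuous fun b => Q a b := fun a =>
    hQc.comp (by fun_prop : Continuous fun b : ℝ => (a, b))
  have e1 : ∀ a ∈ Set.Icc (0 : ℝ) 1, ∀ b ∈ Set.Icc (0 : ℝ) 1,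
      Vb a b = ∫ s in (0 : ℝ)..a, Q s b := by
    intro a ha b hb
    refine ftc (fun a => Vb a b) _ (hQa b) (hVb0 b hb) (fun t ht => ?_) a ha
    simpa only [hQ, hpr_eq t ht, hpr_eq b hb] using hVba t ht b hb
  have e2 : ∀ a ∈ Set.Icc (0 : ℝ) 1, ∀ b ∈ Set.Icc (0 : ℝ) 1,
      V a b = ∫ s in (0 : ℝ)..a, ∫ t in (0 : ℝ)..b, Q s t := by
    intro a ha b hb
    have hc : Continuous fun t => ∫ s in (0 : ℝ)..a, Q s t :=
      intervalIntegral.continuous_parametric_intervalIntegral_of_continuous'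
        (f := fun t s => Q s t) (hQc.comp continuous_swap) 0 a
    rw [ftc (fun b => V a b) _ hc (hV0 a ha) (fun t ht => by
      simpa only [← e1 a ha t ht] using hVb a ha t ht) b hb]
    refine intervalIntegral_intervalIntegral_swap (F := fun t s => Q s t) ?_
    exact ((hQc.comp continuous_swap).continuousOn.integrableOn_compact
      (isCompact_uIcc.prod isCompact_uIcc)).mono_set
      (Set.prod_mono Set.uIoc_subset_uIcc Set.uIoc_subset_uIcc)
  have e3 : ∀ b ∈ Set.Icc (0 : ℝ) 1, Va a b = ∫ t in (0 : ℝ)..b, Q a t := by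
    intro b hb
    have hc : Continuous fun s => ∫ t in (0 : ℝ)..b, Q s t :=
      intervalIntegral.continuous_parametric_intervalIntegral_of_continuous' hQc 0 b
    have h1 : HasDerivWithinAt (fun a => V a b) (∫ t in (0 : ℝ)..b, Q a t) (Set.Icc 0 1) a :=
      ((hc.integral_hasStrictDerivAt 0 a).hasDerivAt.hasDerivWithinAt).congr
        (fun s hs => e2 s hs b hb) (e2 a ha b hb)
    exact (uniqueDiffOn_Icc zero_lt_one a ha).eq_deriv _ (hVa a ha b hb) h1
  have h2 : HasDerivWithinAt (fun b => ∫ t in (0 : ℝ)..b, Q a t) (Q a b) (Set.Icc 0 1) b :=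
    ((hQb a).integral_hasStrictDerivAt 0 b).hasDerivAt.hasDerivWithinAt
  have h3 := h2.congr (fun t ht => e3 t ht) (e3 b hb)
  simpa only [hQ, hpr_eq a ha, hpr_eq b hb] using h3

section CubeDerivatives

variable {d : ℕ} {u : (Fin d → ℝ) → ℝ}

theorem pd_mderiv_of_forall_lt {β : Fin d → ℕ} {k : Fin d} (h : ∀ i < k, β i = 0)
    (u : (Fin d → ℝ) → ℝ) :
    pd d k (mderiv d β u) = mderiv d (Function.update β k (β k + 1)) u := by
  have key : ∀ L : List (Fin d), L.Pairwise (· < ·) → k ∈ L →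
      pd d k (L.foldr (fun i v => (pd d i)^[β i] v) u) =
        L.foldr (fun i v => (pd d i)^[Function.update β k (β k + 1) i] v) u := by
    intro L
    induction L with
    | nil => simp
    | cons i L ih =>
      intro hL hk
      rw [List.pairwise_cons] at hL
      simp only [List.foldr_cons]
      by_cases hik : i = k
      · subst hik
        have : L.foldr (fun j v => (pd d j)^[Function.update β i (β i + 1) j] v) u =
            L.foldr (fun j v => (pd d j)^[β j] v) u :=
          List.foldr_ext (fun j v => (pd d j)^[Function.update β i (β i + 1) j] v)
            (fun j v => (pd d j)^[β j] v) u (l := L) fun j hj v => by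
              rw [Function.update_of_ne (hL.1 j hj).ne']
        rw [this, Function.update_self, Function.iterate_succ_apply']
      · have hkL : k ∈ L := by
          rcases List.mem_cons.1 hk with h | h
          · exact absurd h.symm hik
          · exact h
        rw [Function.update_of_ne hik, h i (hL.1 k hkL)]
        exact ih hL.2 hkL
  exact key _ (List.pairwise_lt_finRange d) (List.mem_finRange k)

theorem update_mem_unitCube {x : Fin d → ℝ} (hx : x ∈ unitCube d) {k : Fin d} {t : ℝ}
    (ht : t ∈ Set.Icc (0 : ℝ) 1) : Function.update x k t ∈ unitCube d := by
  refine ⟨fun i => ?_, fun i => ?_⟩ <;> by_cases h : i = k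
  · subst h; simpa using ht.1
  · simpa [h] using hx.1 i
  · subst h; simpa using ht.2
  · simpa [h] using hx.2 i

theorem update_mem_cubeBdry {x : Fin d → ℝ} (hx : x ∈ unitCube d) {k : Fin d} {t : ℝ}
    (ht : t = 0 ∨ t = 1) : Function.update x k t ∈ cubeBdry d :=
  ⟨update_mem_unitCube hx (by rcases ht with rfl | rfl <;> simp), k, by simpa using ht⟩

/-- The iterated partial derivatives of a function in `X_n^d` may be taken in any order. -/
theorem MemX.hasDerivWithinAt_mderiv {n : ℕ} (hu : MemX d n u) {k : Fin d} {β : Fin d → ℕ}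
    (hβ : ∀ i, β i ≤ n) (hk : β k < n) {x : Fin d → ℝ} (hx : x ∈ unitCube d) :
    HasDerivWithinAt (fun t => mderiv d β u (Function.update x k t))
      (mderiv d (Function.update β k (β k + 1)) u x) (Set.Icc 0 1) (x k) := by
  have hdir : ∀ (β : Fin d → ℕ) (k : Fin d), (∀ i, β i ≤ n) → β k < n → (∀ i < k, β i = 0) →
      ∀ x ∈ unitCube d, HasDerivWithinAt (fun t => mderiv d β u (Function.update x k t))
        (mderiv d (Function.update β k (β k + 1)) u x) (Set.Icc 0 1) (x k) := by
    intro β k hβ hk h x hx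
    rw [← pd_mderiv_of_forall_lt h u]
    exact (hu.1 β hβ k hk x hx).hasDerivWithinAt
  have hup : ∀ (β : Fin d → ℕ) (k : Fin d), (∀ i, β i ≤ n) → β k < n →
      ∀ i, Function.update β k (β k + 1) i ≤ n := by
    intro β k hβ hk i
    by_cases h : i = k
    · subst h; simpa using hk
    · simpa [h] using hβ i
  induction hm : ∑ i ∈ Finset.univ.filter (· < k), β i using Nat.strong_induction_on
    generalizing β x with
  | _ m ih =>
    subst hm
    by_cases h0 : ∀ i < k, β i = 0
    · exact hdir β k hβ hk h0 x hx
    have hne : (Finset.univ.filter fun i => β i ≠ 0).Nonempty := by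
      push Not at h0
      obtain ⟨i, -, hi⟩ := h0
      exact ⟨i, by simpa using hi⟩
    obtain ⟨i, hi, hmin⟩ : ∃ i, β i ≠ 0 ∧ ∀ j < i, β j = 0 := by
      refine ⟨_, (Finset.mem_filter.1 (Finset.min'_mem _ hne)).2, fun j hj => ?_⟩
      by_contra hjβ
      exact absurd (Finset.min'_le _ j (by simpa using hjβ)) (not_le.2 hj)
    have hik : i < k := by
      push Not at h0
      obtain ⟨j, hjk, hj⟩ := h0
      by_contra hik
      exact hj (hmin j (hjk.trans_le (not_lt.1 hik)))
    set γ := Function.update β i (β i - 1) with hγ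
    have hγi : γ i + 1 = β i := by simp [hγ]; omega
    have hγk : γ k = β k := by simp [hγ, hik.ne']
    have hγn : ∀ j, γ j ≤ n := fun j => by
      by_cases h : j = i
      · subst h; have := hβ j; omega
      · simpa [hγ, h] using hβ j
    have hγβ : Function.update γ i (γ i + 1) = β := by rw [hγi, hγ]; simp
    have hγmin : ∀ j < i, γ j = 0 := fun j hj => by simpa [hγ, hj.ne] using hmin j hj
    set δ := Function.update γ k (γ k + 1) with hδ
    have hδi : δ i = γ i := by simp [hδ, hik.ne]
    have hδn := hup γ k hγn (hγk ▸ hk)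
    have hδβ : Function.update δ i (δ i + 1) = Function.update β k (β k + 1) := by
      rw [hδi, hδ, Function.update_comm hik.ne', hγβ, hγk]
    have hlt : ∑ j ∈ Finset.univ.filter (· < k), γ j < ∑ j ∈ Finset.univ.filter (· < k), β j := by
      refine Finset.sum_lt_sum (fun j _ => ?_) ⟨i, by simpa using hik, by omega⟩
      by_cases h : j = i
      · subst h; omega
      · simp [hγ, h]
    have hsl : ∀ a b, Function.update (Function.update x i a) k b =
        Function.update (Function.update x k b) i a := fun a b =>
      Function.update_comm hik.ne _ _ _
    have hmem : ∀ a ∈ Set.Icc (0 : ℝ) 1, ∀ b ∈ Set.Icc (0 : ℝ) 1,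
        Function.update (Function.update x i a) k b ∈ unitCube d := fun a ha b hb =>
      update_mem_unitCube (update_mem_unitCube hx ha) hb
    have hda : ∀ (η : Fin d → ℕ), (∀ j, η j ≤ n) → η i < n → (∀ j < i, η j = 0) →
        ∀ a ∈ Set.Icc (0 : ℝ) 1, ∀ b ∈ Set.Icc (0 : ℝ) 1, HasDerivWithinAt
          (fun a => mderiv d η u (Function.update (Function.update x i a) k b))
          (mderiv d (Function.update η i (η i + 1)) u
            (Function.update (Function.update x i a) k b)) (Set.Icc 0 1) a := by
      intro η hη hηi hη0 a ha b hb
      have := hdir η i hη hηi hη0 _ (hmem a ha b hb)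
      simpa [hsl] using this
    have hγin : γ i < n := by have := hβ i; omega
    have key := hasDerivWithinAt_swap
      (V := fun a b => mderiv d γ u (Function.update (Function.update x i a) k b))
      (Va := fun a b => mderiv d β u (Function.update (Function.update x i a) k b))
      (Vb := fun a b => mderiv d δ u (Function.update (Function.update x i a) k b))
      (P := fun a b => mderiv d (Function.update β k (β k + 1)) u
        (Function.update (Function.update x i a) k b))
      (a := x i) (b := x k) ?_ ?_ ?_ ?_ ?_ ?_ ⟨hx.1 i, hx.2 i⟩ ⟨hx.1 k, hx.2 k⟩
    · simpa using key
    · exact (hu.2 _ (hup β k hβ hk)).1.comp (by fun_prop : Continuous fun p : ℝ × ℝ =>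
        Function.update (Function.update x i p.1) k p.2).continuousOn
        fun p hp => hmem p.1 hp.1 p.2 hp.2
    · exact fun a ha => (hu.2 γ hγn).2 _ (update_mem_cubeBdry (update_mem_unitCube hx ha) (.inl rfl))
    · intro b hb
      simp only [hsl]
      exact (hu.2 δ hδn).2 _ (update_mem_cubeBdry (update_mem_unitCube hx hb) (.inl rfl))
    · simpa only [hγβ] using hda γ hγn hγin hγmin
    · intro a ha b hb
      have := ih _ hlt hγn (hγk ▸ hk) (hmem a ha b hb) rfl
      simpa using this
    · simpa only [hδβ] using hda δ hδn (hδi ▸ hγin) fun j hj => by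
        simpa [hδ, (hj.trans hik).ne] using hγmin j hj

end CubeDerivatives

end Taylor

section OddReflection

open Filter Topology

/-- The `2`-periodic even retraction of the real line onto `[0, 1]`. -/
noncomputable def foldUnit (t : ℝ) : ℝ :=
  if Even ⌊t⌋ then Int.fract t else 1 - Int.fract t

/-- The slope of `foldUnit` to the right of a point. -/
noncomputable def foldSign (t : ℝ) : ℝ := if Even ⌊t⌋ then 1 else -1

theorem abs_foldSign (t : ℝ) : |foldSign t| = 1 := by
  unfold foldSign; split_ifs <;> simp

theorem foldUnit_mem (t : ℝ) : foldUnit t ∈ Set.Icc (0 : ℝ) 1 := by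
  have h0 := Int.fract_nonneg t
  have h1 := (Int.fract_lt_one t).le
  unfold foldUnit
  split_ifs <;> constructor <;> linarith

theorem foldUnit_intCast (n : ℤ) : foldUnit n = 0 ∨ foldUnit n = 1 := by
  unfold foldUnit; split_ifs <;> simp

theorem foldUnit_of_mem {t : ℝ} (ht : t ∈ Set.Ico (0 : ℝ) 1) : foldUnit t = t := by
  have : ⌊t⌋ = 0 := Int.floor_eq_zero_iff.2 ht
  simp [foldUnit, Int.fract, this]

theorem foldSign_of_mem {t : ℝ} (ht : t ∈ Set.Ico (0 : ℝ) 1) : foldSign t = 1 := by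
  have : ⌊t⌋ = 0 := Int.floor_eq_zero_iff.2 ht
  simp [foldSign, this]

theorem floor_eventually_eq {t : ℝ} (ht : ∀ n : ℤ, t ≠ n) : ∀ᶠ y in 𝓝 t, ⌊y⌋ = ⌊t⌋ := by
  have h1 : (⌊t⌋ : ℝ) < t := (Int.floor_le t).lt_of_ne (ht _).symm
  filter_upwards [Ioo_mem_nhds h1 (Int.lt_floor_add_one t)] with y hy
  exact Int.floor_eq_iff.2 ⟨hy.1.le, hy.2⟩

theorem foldSign_eventually_eq {t : ℝ} (ht : ∀ n : ℤ, t ≠ n) :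
    ∀ᶠ y in 𝓝 t, foldSign y = foldSign t := by
  filter_upwards [floor_eventually_eq ht] with y hy
  simp only [foldSign, hy]

theorem hasDerivAt_foldUnit {t : ℝ} (ht : ∀ n : ℤ, t ≠ n) :
    HasDerivAt foldUnit (foldSign t) t := by
  have h : HasDerivAt (fun y => foldUnit t + foldSign t * (y - t)) (foldSign t) t := by
    simpa using (((hasDerivAt_id t).sub_const t).const_mul (foldSign t)).const_add (foldUnit t)
  refine h.congr_of_eventuallyEq ?_
  filter_upwards [floor_eventually_eq ht] with y hy
  simp only [foldUnit, foldSign, Int.fract, hy]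
  split_ifs <;> ring

theorem abs_foldUnit_sub_intCast_le (n : ℤ) {y : ℝ} (hy : |y - n| < 1) :
    |foldUnit y - foldUnit n| ≤ |y - n| := by
  rw [abs_lt] at hy
  rcases le_or_gt (n : ℝ) y with h | h
  · have : ⌊y⌋ = n := Int.floor_eq_iff.2 ⟨h, by linarith⟩
    unfold foldUnit
    simp only [Int.fract, this, Int.floor_intCast]
    split_ifs
    · simp
    · rw [show 1 - (y - n) - (1 - ((n : ℝ) - n)) = -(y - n) by ring, abs_neg]
  · have : ⌊y⌋ = n - 1 := Int.floor_eq_iff.2 ⟨by push_cast; linarith, by push_cast; linarith⟩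
    unfold foldUnit
    simp only [Int.fract, this, Int.floor_intCast, Int.even_sub_one]
    push_cast
    split_ifs
    · rw [show 1 - (y - (n - 1)) - ((n : ℝ) - n) = -(y - n) by ring, abs_neg]
    · rw [show y - (n - 1) - (1 - ((n : ℝ) - n)) = y - n by ring]

theorem continuous_foldUnit : Continuous foldUnit := by
  refine continuous_iff_continuousAt.2 fun t => ?_
  by_cases ht : ∀ n : ℤ, t ≠ n
  · exact (hasDerivAt_foldUnit ht).continuousAt
  · push Not at ht
    obtain ⟨n, rfl⟩ := ht
    rw [ContinuousAt, tendsto_iff_dist_tendsto_zero]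
    refine squeeze_zero' (Eventually.of_forall fun _ => dist_nonneg) (g := fun y : ℝ => |y - n|) ?_ ?_
    · filter_upwards [Metric.ball_mem_nhds (n : ℝ) one_pos] with y hy
      exact abs_foldUnit_sub_intCast_le n hy
    · have : Continuous fun y : ℝ => |y - n| := by fun_prop
      simpa using this.tendsto (n : ℝ)

theorem floor_sub_of_ne {t : ℝ} (ht : ∀ n : ℤ, t ≠ n) (b : ℤ) : ⌊(b : ℝ) - t⌋ = b - 1 - ⌊t⌋ := by
  have h1 : (⌊t⌋ : ℝ) < t := (Int.floor_le t).lt_of_ne (ht _).symm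
  have h2 := Int.lt_floor_add_one t
  refine Int.floor_eq_iff.2 ⟨?_, ?_⟩ <;> push_cast <;> linarith

theorem even_floor_sub {t : ℝ} (ht : ∀ n : ℤ, t ≠ n) {b : ℤ} (hb : Even b) :
    Even ⌊(b : ℝ) - t⌋ ↔ ¬Even ⌊t⌋ := by
  rw [floor_sub_of_ne ht, Int.even_sub, Int.even_sub_one]
  simp [hb]

theorem foldSign_reflect {t : ℝ} (ht : ∀ n : ℤ, t ≠ n) {b : ℤ} (hb : Even b) :
    foldSign (b - t) = -foldSign t := by
  have h := even_floor_sub ht hb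
  unfold foldSign
  by_cases ht' : Even ⌊t⌋ <;> simp [h, ht']

theorem foldUnit_reflect {t : ℝ} (ht : ∀ n : ℤ, t ≠ n) {b : ℤ} (hb : Even b) :
    foldUnit (b - t) = foldUnit t := by
  have h := even_floor_sub ht hb
  unfold foldUnit
  by_cases ht' : Even ⌊t⌋ <;>
  · simp only [h, ht', not_true_eq_false, not_false_eq_true, if_true, if_false]
    simp only [Int.fract, floor_sub_of_ne ht]
    push_cast
    ring

section OddExtension

variable {d : ℕ} {u : (Fin d → ℝ) → ℝ}

/-- The jet of the odd `2`-periodic extension of a function on the unit cube. -/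
noncomputable def oddExt (u : (Fin d → ℝ) → ℝ) (β : Fin d → ℕ) (x : Fin d → ℝ) : ℝ :=
  (∏ i, foldSign (x i) ^ (β i + 1)) * mderiv d β u fun i => foldUnit (x i)

theorem foldUnit_comp_mem (x : Fin d → ℝ) : (fun i => foldUnit (x i)) ∈ unitCube d :=
  ⟨fun i => (foldUnit_mem (x i)).1, fun i => (foldUnit_mem (x i)).2⟩

theorem foldUnit_comp_update (x : Fin d → ℝ) (k : Fin d) (t : ℝ) :
    (fun i => foldUnit (Function.update x k t i)) =
      Function.update (fun i => foldUnit (x i)) k (foldUnit t) := by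
  funext i
  by_cases h : i = k
  · subst h; simp
  · simp [h]

theorem abs_oddExt (β : Fin d → ℕ) (x : Fin d → ℝ) :
    |oddExt u β x| = |mderiv d β u fun i => foldUnit (x i)| := by
  simp [oddExt, abs_mul, Finset.abs_prod, abs_pow, abs_foldSign]

theorem oddExt_update (β : Fin d → ℕ) (x : Fin d → ℝ) (k : Fin d) (t : ℝ) :
    oddExt u β (Function.update x k t) =
      (∏ i ∈ Finset.univ.erase k, foldSign (x i) ^ (β i + 1)) * foldSign t ^ (β k + 1) *
        mderiv d β u (Function.update (fun i => foldUnit (x i)) k (foldUnit t)) := by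
  rw [oddExt, foldUnit_comp_update, ← Finset.mul_prod_erase Finset.univ _ (Finset.mem_univ k),
    Function.update_self, mul_comm (foldSign t ^ (β k + 1))]
  congr 2
  exact Finset.prod_congr rfl fun i hi => by rw [Function.update_of_ne (Finset.ne_of_mem_erase hi)]

theorem MemX.oddExt_eq_zero {n : ℕ} (hu : MemX d n u) {β : Fin d → ℕ} (hβ : ∀ i, β i ≤ n)
    {x : Fin d → ℝ} {k : Fin d} {m : ℤ} (hx : x k = m) : oddExt u β x = 0 := by
  rw [oddExt, (hu.2 β hβ).2 _ ⟨foldUnit_comp_mem x, k, ?_⟩, mul_zero]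
  simpa only [hx] using foldUnit_intCast m

theorem MemX.continuous_oddExt {n : ℕ} (hu : MemX d n u) {β : Fin d → ℕ} (hβ : ∀ i, β i ≤ n) :
    Continuous (oddExt u β) := by
  have hc : Continuous fun x : Fin d → ℝ => mderiv d β u fun i => foldUnit (x i) :=
    (hu.2 β hβ).1.comp_continuous
      (continuous_pi fun i => continuous_foldUnit.comp (continuous_apply i)) foldUnit_comp_mem
  refine continuous_iff_continuousAt.2 fun x => ?_
  by_cases hx : ∀ (k : Fin d) (m : ℤ), x k ≠ m
  · have h : ∀ᶠ y in 𝓝 x, ∀ i, foldSign (y i) = foldSign (x i) :=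
      eventually_all.2 fun i => (continuous_apply i).continuousAt.eventually
        (foldSign_eventually_eq (hx i))
    refine ((hc.const_mul (∏ i, foldSign (x i) ^ (β i + 1))).continuousAt (x := x)).congr ?_
    filter_upwards [h] with y hy
    simp only [oddExt, hy]
  · push Not at hx
    obtain ⟨k, m, hkm⟩ := hx
    have h0 := hu.oddExt_eq_zero hβ hkm
    rw [ContinuousAt, h0, tendsto_zero_iff_abs_tendsto_zero]
    have h1 := (hc.abs.tendsto x)
    rw [← abs_oddExt, h0, abs_zero] at h1
    exact h1.congr fun y => (abs_oddExt β y).symm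

theorem MemX.hasDerivAt_oddExt {n : ℕ} (hu : MemX d n u) {β : Fin d → ℕ} (hβ : ∀ i, β i ≤ n)
    {k : Fin d} (hk : β k < n) (x : Fin d → ℝ) :
    HasDerivAt (fun t => oddExt u β (Function.update x k t))
      (oddExt u (Function.update β k (β k + 1)) x) (x k) := by
  have hβ' : ∀ i, Function.update β k (β k + 1) i ≤ n := fun i => by
    by_cases h : i = k
    · subst h; simpa using hk
    · simpa [h] using hβ i
  have hv := hu.hasDerivWithinAt_mderiv hβ hk (foldUnit_comp_mem x)
  by_cases hx : ∀ m : ℤ, x k ≠ m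
  · have hmem : foldUnit (x k) ∈ Set.Ioo (0 : ℝ) 1 := by
      have h1 : (⌊x k⌋ : ℝ) < x k := (Int.floor_le _).lt_of_ne (hx _).symm
      have h2 := Int.lt_floor_add_one (x k)
      unfold foldUnit Int.fract
      split_ifs <;> constructor <;> linarith
    have h1 := (hv.hasDerivAt (Icc_mem_nhds hmem.1 hmem.2)).comp (x k) (hasDerivAt_foldUnit hx)
    have h2 := h1.const_mul ((∏ i ∈ Finset.univ.erase k, foldSign (x i) ^ (β i + 1)) *
      foldSign (x k) ^ (β k + 1))
    refine (h2.congr_of_eventuallyEq ?_).congr_deriv ?_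
    · filter_upwards [foldSign_eventually_eq hx] with t ht
      rw [oddExt_update, ht]
      rfl
    · have h3 := oddExt_update (u := u) (Function.update β k (β k + 1)) x k (x k)
      rw [Function.update_eq_self, Function.update_eq_self k (fun i => foldUnit (x i))] at h3
      have h4 : ∏ i ∈ Finset.univ.erase k, foldSign (x i) ^ (Function.update β k (β k + 1) i + 1) =
          ∏ i ∈ Finset.univ.erase k, foldSign (x i) ^ (β i + 1) :=
        Finset.prod_congr rfl fun i hi => by
          rw [Function.update_of_ne (Finset.ne_of_mem_erase hi)]
      rw [h3, h4, Function.update_self]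
      ring
  · push Not at hx
    obtain ⟨m, hm⟩ := hx
    rw [hu.oddExt_eq_zero hβ' hm]
    have hbd : (fun i => foldUnit (x i)) ∈ cubeBdry d :=
      ⟨foldUnit_comp_mem x, k, by simpa only [hm] using foldUnit_intCast m⟩
    rw [(hu.2 _ hβ').2 _ hbd, hasDerivWithinAt_iff_isLittleO] at hv
    rw [hasDerivAt_iff_isLittleO]
    simp only [Function.update_eq_self, (hu.2 β hβ).2 _ hbd, hu.oddExt_eq_zero hβ hm, smul_zero,
      sub_zero] at hv ⊢
    have ht : Tendsto foldUnit (𝓝 (x k)) (𝓝[Set.Icc 0 1] (foldUnit (x k))) :=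
      tendsto_nhdsWithin_iff.2 ⟨continuous_foldUnit.tendsto _, Eventually.of_forall foldUnit_mem⟩
    have h1 : (fun t => foldUnit t - foldUnit (x k)) =O[𝓝 (x k)] fun t => t - x k := by
      refine Asymptotics.IsBigO.of_bound 1 ?_
      filter_upwards [Metric.ball_mem_nhds (x k) one_pos] with t ht
      rw [hm] at ht ⊢
      simpa using abs_foldUnit_sub_intCast_le m ht
    refine (Asymptotics.IsBigO.of_bound 1 (Eventually.of_forall fun t => ?_)).trans_isLittleO
      ((hv.comp_tendsto ht).trans_isBigO h1)
    rw [Real.norm_eq_abs, abs_oddExt, foldUnit_comp_update, one_mul]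
    exact le_rfl

theorem MemX.oddExt_reflect {n : ℕ} (hu : MemX d n u) {β : Fin d → ℕ} (hβ : ∀ i, β i ≤ n)
    {k : Fin d} (hk : β k = 0) (x : Fin d → ℝ) {b : ℤ} (hb : Even b) :
    oddExt u β (Function.update x k (b - x k)) = -oddExt u β x := by
  by_cases hx : ∀ m : ℤ, x k ≠ m
  · have h := oddExt_update (u := u) β x k (x k)
    rw [Function.update_eq_self] at h
    rw [h, oddExt_update, foldUnit_reflect hx hb, foldSign_reflect hx hb, hk]
    ring
  · push Not at hx
    obtain ⟨m, hm⟩ := hx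
    rw [hu.oddExt_eq_zero hβ hm, hu.oddExt_eq_zero hβ (k := k) (m := b - m) (by simp [hm]), neg_zero]

theorem MemXb.isOddJet_oddExt {K : ℝ} (hu : MemXb d 4 K u) (lvl : Fin d → ℕ) :
    IsOddJet ∅ lvl (oddExt u) K := by
  have hb : ∀ β : Fin d → ℕ, JetIndex ∅ β → ∀ x, |oddExt u β x| ≤ K := fun β hβ x => by
    rw [abs_oddExt]
    exact hu.2 β hβ.1 _ (foldUnit_comp_mem x)
  refine ⟨fun β hβ k _ hk x _ => hu.1.hasDerivAt_oddExt hβ.1 hk x,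
    fun β hβ => (hu.1.continuous_oddExt hβ.1).continuousOn, ⟨K, fun β hβ x _ => hb β hβ x⟩, ?_,
    fun β hβ _ x _ => hb β hβ x⟩
  rintro β hβ k - hk x - b (rfl | rfl)
  · simpa using hu.1.oddExt_reflect hβ.1 hk x (b := 0) (by simp)
  · simpa using hu.1.oddExt_reflect hβ.1 hk x (b := 2) (by simp)

theorem oddExt_of_mem_openCube (β : Fin d → ℕ) {x : Fin d → ℝ} (hx : x ∈ openCube d) :
    oddExt u β x = mderiv d β u x := by
  have h : ∀ i, x i ∈ Set.Ico (0 : ℝ) 1 := fun i => ⟨(hx i trivial).1.le, (hx i trivial).2⟩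
  simp [oddExt, foldSign_of_mem (h _), foldUnit_of_mem (h _)]

theorem mderiv_zero (u : (Fin d → ℝ) → ℝ) : mderiv d 0 u = u := by
  simp [mderiv]

theorem mderiv_update_two (k : Fin d) (u : (Fin d → ℝ) → ℝ) :
    mderiv d (Function.update 0 k 2) u = pd d k (pd d k u) := by
  have h1 := pd_mderiv_of_forall_lt (β := 0) (k := k) (fun _ _ => rfl) u
  have h2 := pd_mderiv_of_forall_lt (β := Function.update 0 k 1) (k := k)
    (fun i hi => by simp [hi.ne]) u
  rw [mderiv_zero] at h1
  simp only [Pi.zero_apply, zero_add, Function.update_self, Function.update_idem] at h1 h2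
  rw [h1, h2]

theorem MemX.oddExt_zero_eq {n : ℕ} (hu : MemX d n u) {x : Fin d → ℝ} (hx : x ∈ unitCube d) :
    oddExt u 0 x = u x := by
  by_cases h : x ∈ openCube d
  · rw [oddExt_of_mem_openCube 0 h, mderiv_zero]
  · obtain ⟨k, hk⟩ : ∃ k, x k = 0 ∨ x k = 1 := by
      by_contra! hne
      exact h fun k _ => ⟨(hx.1 k).lt_of_ne (hne k).1.symm, (hx.2 k).lt_of_ne (hne k).2⟩
    have h0 := (hu.2 0 fun _ => Nat.zero_le n).2 x ⟨hx, k, hk⟩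
    rw [mderiv_zero] at h0
    rw [h0]
    rcases hk with hk | hk
    · exact hu.oddExt_eq_zero (fun _ => Nat.zero_le n) (m := 0) (by simpa using hk)
    · exact hu.oddExt_eq_zero (fun _ => Nat.zero_le n) (m := 1) (by simpa using hk)

end OddExtension

end OddReflection

section WeightConstruction

open Filter Topology

section PlaneDerivatives

variable {d : ℕ} {J : Finset (Fin d)} {lvl : Fin d → ℕ} {W : (Fin d → ℕ) → (Fin d → ℝ) → ℝ} {M : ℝ}

theorem Iplane_subset_gridPlanes : Iplane d J lvl ⊆ gridPlanes J lvl := by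
  rintro x ⟨hx, hJ⟩ j hj
  obtain ⟨m, hm⟩ := hJ j hj
  have hh := hmesh_pos d lvl j
  have h2 := two_pow_mul_hmesh d lvl j
  have h0 : 0 ≤ x j := hx.1 j
  have h1 : x j ≤ 1 := hx.2 j
  rw [hm] at h0 h1
  have hm0 : 0 ≤ m := by exact_mod_cast nonneg_of_mul_nonneg_left h0 hh
  lift m to ℕ using hm0
  refine ⟨m, ?_, by simpa using hm⟩
  rw [← h2] at h1
  exact_mod_cast le_of_mul_le_mul_right h1 hh

theorem update_mem_Iplane {x : Fin d → ℝ} (hx : x ∈ Iplane d J lvl) {k : Fin d} (hk : k ∉ J)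
    {t : ℝ} (ht : t ∈ Set.Icc (0 : ℝ) 1) : Function.update x k t ∈ Iplane d J lvl := by
  refine ⟨update_mem_unitCube hx.1 ht, fun j hj => ?_⟩
  have : j ≠ k := fun e => hk (e ▸ hj)
  simpa [this] using hx.2 j hj

theorem IsOddJet.iterate_pd (hW : IsOddJet J lvl W M) {β : Fin d → ℕ} (hβ : JetIndex J β)
    {k : Fin d} (hk : k ∉ J) (hβk : β k = 0) {v : (Fin d → ℝ) → ℝ}
    (hv : ∀ x ∈ Iplane d J lvl, v x = W β x) {n : ℕ} (hn : n ≤ 4) :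
    ∀ x ∈ Iplane d J lvl, (pd d k)^[n] v x = W (Function.update β k n) x := by
  induction n with
  | zero =>
    have : Function.update β k 0 = β := by rw [← hβk, Function.update_eq_self]
    simpa [this] using hv
  | succ n ih =>
    intro x hx
    have hx01 : x k ∈ Set.Icc (0 : ℝ) 1 := ⟨hx.1.1 k, hx.1.2 k⟩
    have ih' := ih (by omega)
    rw [Function.iterate_succ_apply', pd,
      derivWithin_congr (fun t ht => ih' _ (update_mem_Iplane hx hk ht))
        (ih' _ (update_mem_Iplane hx hk hx01))]
    have h1 := hW.deriv _ (hβ.update hk (n := n) (by omega)) k hk (by simp; omega) x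
      (Iplane_subset_gridPlanes hx)
    rw [h1.hasDerivWithinAt.derivWithin (uniqueDiffOn_Icc zero_lt_one _ hx01)]
    simp

theorem IsOddJet.mderiv_eq (hW : IsOddJet J lvl W M) {β : Fin d → ℕ} (hβ : JetIndex J β) :
    ∀ x ∈ Iplane d J lvl, mderiv d β (W 0) x = W β x := by
  have key : ∀ L : List (Fin d), L.Nodup → ∀ x ∈ Iplane d J lvl,
      L.foldr (fun i v => (pd d i)^[β i] v) (W 0) x = W (fun i => if i ∈ L then β i else 0) x := by
    intro L
    induction L with
    | nil =>
      intro _ x _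
      simp only [List.foldr_nil, List.not_mem_nil, if_false]
      rfl
    | cons i L ih =>
      intro hL x hx
      rw [List.nodup_cons] at hL
      simp only [List.foldr_cons]
      have hidx : (fun k => if k ∈ i :: L then β k else 0) =
          Function.update (fun k => if k ∈ L then β k else 0) i (β i) := by
        funext k
        by_cases h : k = i
        · subst h; simp
        · simp [h]
      have hJL : JetIndex J fun k => if k ∈ L then β k else 0 := by
        refine ⟨fun k => ?_, fun j hj => ?_⟩ <;> dsimp only <;> split_ifs
        · exact hβ.1 k
        · omega
        · exact hβ.2 j hj
        · rfl
      rw [hidx]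
      by_cases hi : i ∈ J
      · rw [hβ.2 i hi, Function.iterate_zero, id, ih hL.2 x hx, Function.update_eq_self_iff.2]
        simp [hL.1]
      · exact hW.iterate_pd hJL hi (by simp [hL.1]) (ih hL.2) (hβ.1 i) x hx
  intro x hx
  have := key _ (List.nodup_finRange d) x hx
  simpa [mderiv] using this

theorem IsOddJet.hasDerivsOn (hW : IsOddJet J lvl W M) {α : Fin d → ℕ} (hα : JetIndex J α) :
    HasDerivsOn d α (W 0) (Iplane d J lvl) := by
  intro β hβ i hi x hx
  have hiJ : i ∉ J := fun h => by have := hα.2 i h; omega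
  have hβJ : JetIndex J β := ⟨fun k => (hβ k).trans (hα.1 k), fun j hj => by
    have := hα.2 j hj
    have := hβ j
    omega⟩
  have hx01 : x i ∈ Set.Icc (0 : ℝ) 1 := ⟨hx.1.1 i, hx.1.2 i⟩
  have h1 := hW.deriv β hβJ i hiJ (by have := hα.1 i; omega) x (Iplane_subset_gridPlanes hx)
  exact h1.hasDerivWithinAt.differentiableWithinAt.congr
    (fun t ht => hW.mderiv_eq hβJ _ (update_mem_Iplane hx hiJ ht))
    (hW.mderiv_eq hβJ _ (update_mem_Iplane hx hiJ hx01))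

end PlaneDerivatives

section Weights

variable {d : ℕ} {J : Finset (Fin d)} {lvl lvl' : Fin d → ℕ}
  {G W : (Fin d → ℕ) → (Fin d → ℝ) → ℝ} {M : ℝ}

/-- `W` solves the Poisson problem with right-hand side `G`, discretised in the directions `J`,
with zero boundary values in these directions. -/
def IsSemidiscreteSol (J : Finset (Fin d)) (lvl : Fin d → ℕ)
    (G W : (Fin d → ℕ) → (Fin d → ℝ) → ℝ) : Prop :=
  (∀ β, ∀ x ∈ gridPlanes J lvl, (∃ j ∈ J, x j = 0 ∨ x j = 1) → W β x = 0) ∧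
  ∀ x ∈ gridPlanes J lvl, (∀ j ∈ J, 0 < x j ∧ x j < 1) →
    ∑ j ∈ J, (W 0 (Function.update x j (x j + hmesh d lvl j)) - 2 * W 0 x
        + W 0 (Function.update x j (x j - hmesh d lvl j))) / hmesh d lvl j ^ 2
      + ∑ k ∈ Jᶜ, W (Function.update 0 k 2) x = G 0 x

theorem hmesh_congr {j : Fin d} (h : lvl j = lvl' j) : hmesh d lvl j = hmesh d lvl' j := by
  simp only [hmesh, h]

theorem gridPlanes_congr (h : ∀ j ∈ J, lvl j = lvl' j) : gridPlanes J lvl = gridPlanes J lvl' := by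
  ext x
  exact forall₂_congr fun j hj => by rw [hmesh_congr (h j hj), h j hj]

theorem truncJet_congr {j : Fin d} (h : lvl j = lvl' j)
    (W : (Fin d → ℕ) → (Fin d → ℝ) → ℝ) : truncJet lvl j W = truncJet lvl' j W := by
  funext β x
  simp only [truncJet, hmesh_congr h]

theorem IsOddJet.congr (h : ∀ j ∈ J, lvl j = lvl' j) (hW : IsOddJet J lvl W M) :
    IsOddJet J lvl' W M := by
  obtain ⟨h1, h2, h3, h4, h5⟩ := hW
  rw [gridPlanes_congr h] at h1 h2 h3 h4 h5
  exact ⟨h1, h2, h3, h4, h5⟩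

theorem IsSemidiscreteSol.congr (h : ∀ j ∈ J, lvl j = lvl' j) (hW : IsSemidiscreteSol J lvl G W) :
    IsSemidiscreteSol J lvl' G W := by
  obtain ⟨h1, h2⟩ := hW
  rw [gridPlanes_congr h] at h1 h2
  refine ⟨h1, fun x hx hx' => ?_⟩
  rw [← h2 x hx hx']
  congr 1
  exact Finset.sum_congr rfl fun j hj => by rw [hmesh_congr (h j hj)]

/-- The jets of the weight functions of the error expansion, indexed by the number `n` of
discretised directions. The jet for `n = 0` is that of `-u`. -/
noncomputable def weightJet (K : ℝ) (u : (Fin d → ℝ) → ℝ) :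
    ℕ → Finset (Fin d) → (Fin d → ℕ) → (Fin d → ℕ) → (Fin d → ℝ) → ℝ
  | 0, _, _ => fun β x => -oddExt u β x
  | n + 1, J, lvl => Classical.epsilon fun W =>
      IsOddJet J lvl W (K * ((n + 1).factorial : ℝ) / 96 ^ (n + 1)) ∧
      IsSemidiscreteSol J lvl
        (fun β x => -∑ j ∈ J, truncJet lvl j (weightJet K u n (J.erase j) lvl) β x) W

theorem weightJet_congr (K : ℝ) (u : (Fin d → ℝ) → ℝ) (n : ℕ) :
    ∀ (J : Finset (Fin d)) (lvl lvl' : Fin d → ℕ), (∀ j ∈ J, lvl j = lvl' j) →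
      weightJet K u n J lvl = weightJet K u n J lvl' := by
  induction n with
  | zero => intro J lvl lvl' _; rfl
  | succ n ih =>
    intro J lvl lvl' h
    have hG : (fun β x => -∑ j ∈ J, truncJet lvl j (weightJet K u n (J.erase j) lvl) β x) =
        fun β x => -∑ j ∈ J, truncJet lvl' j (weightJet K u n (J.erase j) lvl') β x := by
      funext β x
      congr 1
      exact Finset.sum_congr rfl fun j hj => by
        rw [truncJet_congr (h j hj), ih _ lvl lvl' fun i hi => h i (Finset.mem_of_mem_erase hi)]
    rw [weightJet, weightJet, hG]
    congr 1
    funext W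
    have h' : ∀ j ∈ J, lvl' j = lvl j := fun j hj => (h j hj).symm
    exact propext ⟨fun hW => ⟨hW.1.congr h, hW.2.congr h⟩, fun hW => ⟨hW.1.congr h', hW.2.congr h'⟩⟩

theorem weightJet_succ_spec {K : ℝ} {u : (Fin d → ℝ) → ℝ} {n : ℕ} (hJ : J.card = n + 1)
    (h : ∀ j ∈ J, IsOddJet (J.erase j) lvl (weightJet K u n (J.erase j) lvl)
      (K * (n.factorial : ℝ) / 96 ^ n)) :
    IsOddJet J lvl (weightJet K u (n + 1) J lvl) (K * ((n + 1).factorial : ℝ) / 96 ^ (n + 1)) ∧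
      IsSemidiscreteSol J lvl
        (fun β x => -∑ j ∈ J, truncJet lvl j (weightJet K u n (J.erase j) lvl) β x)
        (weightJet K u (n + 1) J lvl) := by
  have hG := IsOddJet.neg_sum (J := J) J fun j hj => (h j hj).truncJet hj
  obtain ⟨W, hW, h0, heq⟩ := exists_semidiscrete_solution (Finset.card_pos.1 (by omega)) hG
  rw [weightJet]
  refine Classical.epsilon_spec (p := fun W =>
      IsOddJet J lvl W (K * ((n + 1).factorial : ℝ) / 96 ^ (n + 1)) ∧
      IsSemidiscreteSol J lvl
        (fun β x => -∑ j ∈ J, truncJet lvl j (weightJet K u n (J.erase j) lvl) β x) W)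
    ⟨W, ?_, h0, heq⟩
  convert hW using 1
  rw [hJ, Nat.factorial_succ]
  push_cast
  ring

theorem isOddJet_weightJet {K : ℝ} {u : (Fin d → ℝ) → ℝ} (hu : MemXb d 4 K u) (n : ℕ) :
    ∀ J : Finset (Fin d), J.card = n →
      IsOddJet J lvl (weightJet K u n J lvl) (K * (n.factorial : ℝ) / 96 ^ n) := by
  induction n with
  | zero =>
    intro J hJ
    rw [Finset.card_eq_zero] at hJ
    subst hJ
    simpa [weightJet] using IsOddJet.neg_sum {()} (G := fun _ => oddExt u)
      fun _ _ => hu.isOddJet_oddExt lvl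
  | succ n ih =>
    intro J hJ
    exact (weightJet_succ_spec hJ fun j hj => ih _ (by rw [Finset.card_erase_of_mem hj, hJ]; rfl)).1

theorem isSemidiscreteSol_weightJet {K : ℝ} {u : (Fin d → ℝ) → ℝ} (hu : MemXb d 4 K u)
    (hJ : J.Nonempty) : IsSemidiscreteSol J lvl
      (fun β x => -∑ j ∈ J, truncJet lvl j (weightJet K u (J.erase j).card (J.erase j) lvl) β x)
      (weightJet K u J.card J lvl) := by
  obtain ⟨n, hn⟩ : ∃ n, J.card = n + 1 := ⟨J.card - 1, by have := hJ.card_pos; omega⟩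
  have hc : ∀ j ∈ J, (J.erase j).card = n := fun j hj => by
    rw [Finset.card_erase_of_mem hj, hn]; rfl
  have h := (weightJet_succ_spec (lvl := lvl) hn
    fun j hj => isOddJet_weightJet hu n _ (hc j hj)).2
  rw [hn]
  convert h using 4
  exact Finset.sum_congr rfl fun j hj => by rw [hc j hj]

end Weights

end WeightConstruction

section Expansion

variable {d : ℕ} {lvl : Fin d → ℕ}

theorem gridpt_mem_gridPlanes {i : Fin d → ℕ} (hi : IsGridIdx d lvl i) (J : Finset (Fin d)) :
    gridpt d lvl i ∈ gridPlanes J lvl := fun j _ => ⟨i j, hi j, rfl⟩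

theorem gridpt_update_succ (i : Fin d → ℕ) (k : Fin d) :
    gridpt d lvl (Function.update i k (i k + 1)) =
      Function.update (gridpt d lvl i) k (gridpt d lvl i k + hmesh d lvl k) := by
  funext j
  by_cases h : j = k
  · subst h; simp [gridpt, add_mul]
  · simp [gridpt, h]

theorem gridpt_update_pred {i : Fin d → ℕ} {k : Fin d} (hk : 1 ≤ i k) :
    gridpt d lvl (Function.update i k (i k - 1)) =
      Function.update (gridpt d lvl i) k (gridpt d lvl i k - hmesh d lvl k) := by
  funext j
  by_cases h : j = k
  · subst h; simp [gridpt, Nat.cast_sub hk, sub_mul]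
  · simp [gridpt, h]

theorem gridpt_mem_Ioo {i : Fin d → ℕ} {k : Fin d} (hk : 1 ≤ i k ∧ i k < 2 ^ lvl k) :
    gridpt d lvl i k ∈ Set.Ioo (0 : ℝ) 1 := by
  have hh := hmesh_pos d lvl k
  have h1 : (1 : ℝ) ≤ i k := by exact_mod_cast hk.1
  have h2 : (i k : ℝ) < 2 ^ lvl k := by exact_mod_cast hk.2
  refine ⟨by simp only [gridpt]; positivity, ?_⟩
  rw [gridpt, ← two_pow_mul_hmesh d lvl k]
  gcongr

theorem gridpt_mem_unitCube {i : Fin d → ℕ} (hi : IsGridIdx d lvl i) :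
    gridpt d lvl i ∈ unitCube d := by
  refine ⟨fun k => ?_, fun k => ?_⟩ <;> have hh := hmesh_pos d lvl k
  · simp only [gridpt, Pi.zero_apply]; positivity
  · have h2 : (i k : ℝ) ≤ 2 ^ lvl k := by exact_mod_cast hi k
    rw [gridpt, Pi.one_apply, ← two_pow_mul_hmesh d lvl k]
    gcongr

theorem gridpt_eq_zero_or_one {i : Fin d → ℕ} {k : Fin d} (hk : i k = 0 ∨ i k = 2 ^ lvl k) :
    gridpt d lvl i k = 0 ∨ gridpt d lvl i k = 1 := by
  rcases hk with h | h
  · exact .inl (by simp [gridpt, h])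
  · exact .inr (by simp [gridpt, h, two_pow_mul_hmesh])

theorem IsOddJet.eq_zero_of_boundary {J : Finset (Fin d)} {W : (Fin d → ℕ) → (Fin d → ℝ) → ℝ}
    {M : ℝ} (hW : IsOddJet J lvl W M) {x : Fin d → ℝ} (hx : x ∈ gridPlanes J lvl) {k : Fin d}
    (hk : k ∉ J) (hxk : x k = 0 ∨ x k = 1) : W 0 x = 0 := by
  have key : ∀ b : ℝ, b = 0 ∨ b = 2 → b - x k = x k → W 0 x = 0 := by
    intro b hb hbx
    have := hW.odd 0 JetIndex.zero k hk rfl x hx b hb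
    rw [hbx, Function.update_eq_self] at this
    linarith
  rcases hxk with h | h
  · exact key 0 (.inl rfl) (by rw [h]; norm_num)
  · exact key 2 (.inr rfl) (by rw [h]; norm_num)

theorem sum_erase_eq_sum_notMem {M : Type*} [AddCommMonoid M] (F : Fin d → Finset (Fin d) → M) :
    ∑ J : Finset (Fin d), ∑ j ∈ J, F j (J.erase j) = ∑ J : Finset (Fin d), ∑ j ∈ Jᶜ, F j J := by
  have h1 : ∑ J : Finset (Fin d), ∑ j ∈ J, F j (J.erase j) =
      ∑ j, ∑ J ∈ Finset.univ.filter (fun J : Finset (Fin d) => j ∈ J), F j (J.erase j) :=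
    Finset.sum_comm' (by simp)
  have h2 : ∑ J : Finset (Fin d), ∑ j ∈ Jᶜ, F j J =
      ∑ j, ∑ J ∈ Finset.univ.filter (fun J : Finset (Fin d) => j ∉ J), F j J :=
    Finset.sum_comm' (by simp)
  rw [h1, h2]
  refine Finset.sum_congr rfl fun j _ => ?_
  refine Finset.sum_nbij' (fun J => J.erase j) (fun J => insert j J) ?_ ?_ ?_ ?_ ?_
  · simp
  · simp
  · intro J hJ; exact Finset.insert_erase (by simpa using hJ)
  · intro J hJ; exact Finset.erase_insert (by simpa using hJ)
  · simp

/-- If the semidiscrete equations hold for all sets of directions, the discrete Laplacian of the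
error expansion telescopes. -/
theorem sum_second_difference_expansion {e : Finset (Fin d) → (Fin d → ℕ) → (Fin d → ℝ) → ℝ}
    {x : Fin d → ℝ} {c : ℝ}
    (hempty : ∑ k, e ∅ (Function.update 0 k 2) x = -c)
    (heq : ∀ J : Finset (Fin d), J.Nonempty →
      ∑ j ∈ J, (e J 0 (Function.update x j (x j + hmesh d lvl j)) - 2 * e J 0 x
        + e J 0 (Function.update x j (x j - hmesh d lvl j))) / hmesh d lvl j ^ 2
      + ∑ k ∈ Jᶜ, e J (Function.update 0 k 2) x
        = -∑ j ∈ J, truncJet lvl j (e (J.erase j)) 0 x) :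
    ∑ J : Finset (Fin d), (∑ k, (e J 0 (Function.update x k (x k + hmesh d lvl k)) - 2 * e J 0 x
        + e J 0 (Function.update x k (x k - hmesh d lvl k))) / hmesh d lvl k ^ 2)
      * ∏ j ∈ J, hmesh d lvl j ^ 2 = -c := by
  set F : Fin d → Finset (Fin d) → ℝ := fun k J =>
    hmesh d lvl k ^ 2 * truncJet lvl k (e J) 0 x * ∏ j ∈ J, hmesh d lvl j ^ 2 with hF
  have hterm : ∀ J : Finset (Fin d),
      (∑ k, (e J 0 (Function.update x k (x k + hmesh d lvl k)) - 2 * e J 0 x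
        + e J 0 (Function.update x k (x k - hmesh d lvl k))) / hmesh d lvl k ^ 2)
      * ∏ j ∈ J, hmesh d lvl j ^ 2 =
      (if J = ∅ then -c else 0) - ∑ j ∈ J, F j (J.erase j) + ∑ k ∈ Jᶜ, F k J := by
    intro J
    have h1 : ∑ j ∈ J, F j (J.erase j) =
        (∑ j ∈ J, truncJet lvl j (e (J.erase j)) 0 x) * ∏ j ∈ J, hmesh d lvl j ^ 2 := by
      rw [Finset.sum_mul]
      refine Finset.sum_congr rfl fun j hj => ?_
      rw [← Finset.mul_prod_erase J _ hj]
      ring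
    have h2 : ∑ k ∈ Jᶜ, F k J =
        (∑ k ∈ Jᶜ, ((e J 0 (Function.update x k (x k + hmesh d lvl k)) - 2 * e J 0 x
          + e J 0 (Function.update x k (x k - hmesh d lvl k))) / hmesh d lvl k ^ 2
          - e J (Function.update 0 k 2) x)) * ∏ j ∈ J, hmesh d lvl j ^ 2 := by
      rw [Finset.sum_mul]
      refine Finset.sum_congr rfl fun k _ => ?_
      have := (hmesh_pos d lvl k).ne'
      simp only [hF, truncJet]
      field_simp
    rw [h1, h2, Finset.sum_sub_distrib, ← Finset.sum_add_sum_compl J]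
    by_cases hJ : J = ∅
    · subst hJ
      simp only [Finset.compl_empty, hempty, Finset.sum_empty, Finset.prod_empty, if_true]
      ring
    · have := heq J (Finset.nonempty_iff_ne_empty.2 hJ)
      rw [if_neg hJ, eq_sub_of_add_eq this]
      ring
  rw [Finset.sum_congr rfl fun J _ => hterm J, Finset.sum_add_distrib, Finset.sum_sub_distrib,
    sum_erase_eq_sum_notMem]
  simp

end Expansion

section Expansion

variable {d : ℕ} {lvl : Fin d → ℕ}

theorem MemXb.gridFunction_add_expansion_eq_zero (hd : 1 ≤ d) {K : ℝ} {f u : (Fin d → ℝ) → ℝ}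
    (hu : MemXb d 4 K u) (heq : ∀ x ∈ openCube d, ∑ i, pd d i (pd d i u) x = f x)
    {U : (Fin d → ℕ) → ℝ} (hU : IsFDPoisson d lvl f U) :
    ∀ i, IsGridIdx d lvl i → U i + ∑ J : Finset (Fin d),
      weightJet K u J.card J lvl 0 (gridpt d lvl i) * ∏ j ∈ J, hmesh d lvl j ^ 2 = 0 := by
  refine eq_zero_of_discrete_harmonic hd (lvl := lvl) ?_ ?_
  · rintro i hi ⟨k, hk⟩
    rw [hU.1 i hi ⟨k, hk⟩, zero_add]
    refine Finset.sum_eq_zero fun J _ => ?_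
    have hx := gridpt_mem_gridPlanes hi J
    have hxk := gridpt_eq_zero_or_one hk
    by_cases hkJ : k ∈ J
    · rw [(isSemidiscreteSol_weightJet hu ⟨k, hkJ⟩).1 0 _ hx ⟨k, hkJ, hxk⟩, zero_mul]
    · rw [(isOddJet_weightJet hu _ J rfl).eq_zero_of_boundary hx hkJ hxk, zero_mul]
  · intro i hi
    have hidx : IsGridIdx d lvl i := fun k => (hi k).2.le
    have hIoo : ∀ k, gridpt d lvl i k ∈ Set.Ioo (0 : ℝ) 1 := fun k => gridpt_mem_Ioo (hi k)
    have hopen : gridpt d lvl i ∈ openCube d := fun k _ => hIoo k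
    have key := sum_second_difference_expansion (lvl := lvl)
      (e := fun J => weightJet K u J.card J lvl) (x := gridpt d lvl i)
      (c := f (gridpt d lvl i)) ?_ fun J hJ =>
        (isSemidiscreteSol_weightJet hu hJ).2 _ (gridpt_mem_gridPlanes hidx J) fun j _ => hIoo j
    · have hf := hU.2 i hi
      have hsplit : ∀ k, gridpt d lvl (Function.update i k (i k - 1)) =
          Function.update (gridpt d lvl i) k (gridpt d lvl i k - hmesh d lvl k) :=
        fun k => gridpt_update_pred (hi k).1
      simp only [gridpt_update_succ, hsplit]
      rw [← add_neg_cancel (f (gridpt d lvl i)), ← key, ← hf]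
      simp_rw [Finset.sum_mul]
      rw [Finset.sum_comm, ← Finset.sum_add_distrib]
      refine Finset.sum_congr rfl fun k _ => ?_
      simp only [div_mul_eq_mul_div, ← Finset.sum_div, add_mul, sub_mul, Finset.sum_add_distrib,
        Finset.sum_sub_distrib, mul_assoc, ← Finset.mul_sum]
      ring
    · simp only [Finset.card_empty, weightJet, Finset.sum_neg_distrib, neg_inj]
      rw [← heq _ hopen]
      exact Finset.sum_congr rfl fun k _ => by
        rw [oddExt_of_mem_openCube _ hopen, mderiv_update_two]

end Expansion

/-- Error expansion on the grid for the Poisson problem with smooth weights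
(Theorem `expansion-on-grid` together with Corollary `corollary-smoothness`):
the weights `w_J` can be chosen so that in addition all derivatives
`D^α w_J`, `α ∈ {0,4}^d`, `α_j = 0` for `j ∈ J`, exist along the hyperplanes
`I^{(J)}` and are bounded by `K·m!/96^m`. -/
theorem poisson_error_expansion_on_grid_smooth_weights (d : ℕ) (hd : 1 ≤ d)
    (K : ℝ) (hK : 0 < K)
    (f u : (Fin d → ℝ) → ℝ) (hu : MemXb d 4 K u)
    (heq : ∀ x ∈ openCube d, ∑ i, pd d i (pd d i u) x = f x)
    (hzero : ∀ x ∈ cubeBdry d, u x = 0) :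
    ∃ w : Finset (Fin d) → (Fin d → ℕ) → (Fin d → ℝ) → ℝ,
      (∀ (J : Finset (Fin d)) (lvl lvl' : Fin d → ℕ),
        (∀ j ∈ J, lvl j = lvl' j) → w J lvl = w J lvl') ∧
      (∀ J : Finset (Fin d), J.Nonempty → ∀ lvl : Fin d → ℕ,
        ContinuousOn (w J lvl) (Iplane d J lvl) ∧
        (∀ x ∈ Iplane d J lvl,
          |w J lvl x| ≤ K * (Nat.factorial J.card : ℝ) / (96 : ℝ) ^ J.card) ∧
        (∀ α : Fin d → ℕ, (∀ i, α i = 0 ∨ α i = 4) → (∀ j ∈ J, α j = 0) →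
          HasDerivsOn d α (w J lvl) (Iplane d J lvl) ∧
          ∀ x ∈ Iplane d J lvl,
            |mderiv d α (w J lvl) x| ≤ K * (Nat.factorial J.card : ℝ) / (96 : ℝ) ^ J.card)) ∧
      (∀ lvl : Fin d → ℕ, ∀ U : (Fin d → ℕ) → ℝ, IsFDPoisson d lvl f U →
        ∀ i : Fin d → ℕ, IsGridIdx d lvl i →
          u (gridpt d lvl i) - U i =
            ∑ J ∈ Finset.univ.filter (fun J : Finset (Fin d) => J.Nonempty),
              w J lvl (gridpt d lvl i) * ∏ j ∈ J, hmesh d lvl j ^ 2) := by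
  refine ⟨fun J lvl => weightJet K u J.card J lvl 0, fun J lvl lvl' h => ?_,
    fun J _ lvl => ?_, fun lvl U hU i hi => ?_⟩
  · simp only [weightJet_congr K u J.card J lvl lvl' h]
  · have hW := isOddJet_weightJet (lvl := lvl) hu _ J rfl
    refine ⟨(hW.cont 0 JetIndex.zero).mono Iplane_subset_gridPlanes, fun x hx =>
      hW.bound 0 JetIndex.zero (fun _ => .inl rfl) x (Iplane_subset_gridPlanes hx),
      fun α hα hαJ => ?_⟩
    have hαi : JetIndex J α := ⟨fun k => by rcases hα k with h | h <;> omega, hαJ⟩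
    refine ⟨hW.hasDerivsOn hαi, fun x hx => ?_⟩
    rw [hW.mderiv_eq hαi x hx]
    exact hW.bound α hαi hα x (Iplane_subset_gridPlanes hx)
  · have h := hu.gridFunction_add_expansion_eq_zero hd heq hU i hi
    have hset : Finset.univ.filter (fun J : Finset (Fin d) => J.Nonempty) =
        Finset.univ.erase ∅ := by
      ext J
      simp [Finset.nonempty_iff_ne_empty]
    rw [← Finset.add_sum_erase Finset.univ _ (Finset.mem_univ ∅)] at h
    simp only [Finset.card_empty, weightJet, Finset.prod_empty, mul_one,
      hu.1.oddExt_zero_eq (gridpt_mem_unitCube hi)] at h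
    rw [hset]
    linarith
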